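/- arXiv:2201.08376 — 2 statements merged into one kernel-verified Lean document; each statement's English description precedes it below -/
import Mathlib

section
/- Let q > 9 be odd and let U be an intersecting family of polynomials over F_q of degree at most 2. For b ∈ F_q let C_b = {c ∈ F_q : there exists a ∈ F_q with a + bx + cx^2 ∈ U}, and let doM = {b ∈ F_q : |C_b| > q − √q/2 + 1/2}. If |doM| > q/2, then there exist α, β ∈ F_q such that g(α) = β for every polynomial g = a + bx + cx^2 ∈ U with b ∈ doM. -/
open Polynomial

lemma s15_sum_pair {F : Type*} [Field F] [Fintype F] [DecidableEq F] (h2 : ringChar F ≠ 2)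
    (x x' : F) (h : x ≠ x') :
    ∑ y : F, quadraticChar F (x - y) * quadraticChar F (x' - y) = -1 := by
  have h0 : ∑ w : F, quadraticChar F w = 0 := quadraticChar_sum_zero h2
  have key : ∑ y ∈ Finset.univ.erase x', quadraticChar F (x - y) * quadraticChar F (x' - y)
      = ∑ w ∈ Finset.univ.erase (1:F), quadraticChar F w := by
    refine Finset.sum_bij' (fun y _ => (x - y) / (x' - y)) (fun w _ => (x - w * x') / (1 - w)) ?_ ?_ ?_ ?_ ?_
    · intro y hy
      have hy' : x' - y ≠ 0 := sub_ne_zero.2 (Finset.ne_of_mem_erase hy).symm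
      simp only [Finset.mem_erase, Finset.mem_univ, and_true]
      intro h1
      rw [div_eq_one_iff_eq hy'] at h1
      exact h (by linear_combination h1)
    · intro w hw
      have hw' : 1 - w ≠ 0 := sub_ne_zero.2 (Finset.ne_of_mem_erase hw).symm
      simp only [Finset.mem_erase, Finset.mem_univ, and_true]
      intro h1
      rw [div_eq_iff hw'] at h1
      exact h (by linear_combination h1)
    · intro y hy
      have hy' : x' - y ≠ 0 := sub_ne_zero.2 (Finset.ne_of_mem_erase hy).symm
      have : 1 - (x - y) / (x' - y) ≠ 0 := by
        rw [Ne, sub_eq_zero, eq_comm, div_eq_one_iff_eq hy']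
        intro h1; exact h (by linear_combination h1)
      have h3 : x' - x ≠ 0 := sub_ne_zero.2 h.symm
      have e1 : 1 - (x - y) / (x' - y) = (x' - x) / (x' - y) := by field_simp; ring
      rw [e1]
      field_simp
      ring
    · intro w hw
      have hw' : 1 - w ≠ 0 := sub_ne_zero.2 (Finset.ne_of_mem_erase hw).symm
      have h3 : x' - x ≠ 0 := sub_ne_zero.2 h.symm
      have e1 : x' - (x - w * x') / (1 - w) = (x' - x) / (1 - w) := by field_simp; ring
      rw [e1]
      field_simp
      ring
    · intro y hy
      have hy' : x' - y ≠ 0 := sub_ne_zero.2 (Finset.ne_of_mem_erase hy).symm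
      have e1 : (x - y) * (x' - y) = (x - y) / (x' - y) * (x' - y)^2 := by field_simp
      rw [← map_mul, e1, map_mul, quadraticChar_sq_one' hy', mul_one]
  have e2 := Finset.sum_erase_add Finset.univ (fun w : F => quadraticChar F w) (Finset.mem_univ (1:F))
  have e3 := Finset.sum_erase_add Finset.univ (fun y : F => quadraticChar F (x - y) * quadraticChar F (x' - y)) (Finset.mem_univ x')
  simp only [sub_self, quadraticChar_zero, mul_zero, add_zero, map_one] at e2 e3
  rw [← e3, key]; linarith

lemma s15_sum_self {F : Type*} [Field F] [Fintype F] [DecidableEq F] (x : F) :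
    ∑ y : F, quadraticChar F (x - y) * quadraticChar F (x - y) = Fintype.card F - 1 := by
  have e3 := Finset.sum_erase_add Finset.univ (fun y : F => quadraticChar F (x - y) * quadraticChar F (x - y)) (Finset.mem_univ x)
  rw [← e3]
  simp only [sub_self, quadraticChar_zero, mul_zero, add_zero]
  rw [Finset.sum_congr rfl (g := fun _ => (1:ℤ))]
  · rw [Finset.sum_const, Finset.card_erase_of_mem (Finset.mem_univ _), Finset.card_univ]
    have : 1 ≤ Fintype.card F := Fintype.card_pos
    simp [Nat.cast_sub this]
  · intro y hy
    have hy' : x - y ≠ 0 := sub_ne_zero.2 (Finset.ne_of_mem_erase hy).symm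
    rw [← map_mul, ← sq, quadraticChar_sq_one' hy']

lemma s15_inj_or_const {F : Type*} [Field F] [Fintype F] (h2 : ringChar F ≠ 2)
    (C : Finset F) (φ : F → F) (ε : ℕ) (hC : C.card + ε = Fintype.card F)
    (hε : 2 * ε + 2 < Fintype.card F)
    (hsq : ∀ x ∈ C, ∀ y ∈ C, IsSquare ((φ x - φ y) * (x - y))) :
    Set.InjOn φ C ∨ ∃ γ, ∀ c ∈ C, φ c = γ := by
  classical
  by_contra hcon
  push Not at hcon
  obtain ⟨hni, hnc⟩ := hcon
  have : ∃ x1 ∈ C, ∃ x2 ∈ C, φ x1 = φ x2 ∧ x1 ≠ x2 := by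
    by_contra hh
    push Not at hh
    exact hni (fun x hx y hy hxy => hh x hx y hy hxy)
  obtain ⟨x1, hx1, x2, hx2, h12, hne⟩ := this
  obtain ⟨y0, hy0, hy0'⟩ := hnc (φ x1)
  set L := C.filter (fun x => φ x = φ x1) with hL
  set M := C.filter (fun x => ¬ φ x = φ x1) with hM
  have hLM : L.card + M.card = C.card := Finset.card_filter_add_card_filter_not _
  have hL2 : 2 ≤ L.card := by
    have : ({x1, x2} : Finset F) ⊆ L := by
      intro z hz
      simp only [Finset.mem_insert, Finset.mem_singleton] at hz
      rcases hz with rfl | rfl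
      · simp [hL, hx1]
      · simp [hL, hx2, h12]
    calc 2 = ({x1, x2} : Finset F).card := (Finset.card_pair hne).symm
      _ ≤ _ := Finset.card_le_card this
  have hM1 : 1 ≤ M.card := Finset.card_pos.2 ⟨y0, by simp [hM, hy0, hy0']⟩
  have hval : ∀ y ∈ M, (∑ x ∈ L, quadraticChar F (x - y))^2 = (L.card : ℤ)^2 := by
    intro y hy
    simp only [hM, Finset.mem_filter] at hy
    have h1 : ∀ x ∈ L, quadraticChar F (x - y) = quadraticChar F (φ x1 - φ y) := by
      intro x hx
      simp only [hL, Finset.mem_filter] at hx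
      have ha : φ x1 - φ y ≠ 0 := sub_ne_zero.2 (Ne.symm hy.2)
      have hb : x - y ≠ 0 := by
        rw [sub_ne_zero]; rintro rfl; exact hy.2 hx.2
      have h3 := hsq x hx.1 y hy.1
      rw [hx.2] at h3
      have h4 := (quadraticChar_one_iff_isSquare (mul_ne_zero ha hb)).2 h3
      rw [map_mul] at h4
      rcases quadraticChar_dichotomy ha with h | h <;> rcases quadraticChar_dichotomy hb with h' | h' <;>
        rw [h, h'] at h4 ⊢ <;> norm_num at h4
    rw [Finset.sum_congr rfl h1, Finset.sum_const, nsmul_eq_mul, mul_pow, ← map_pow,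
      quadraticChar_sq_one', mul_one]
    exact sub_ne_zero.2 (Ne.symm hy.2)
  have htot : ∑ y : F, (∑ x ∈ L, quadraticChar F (x - y))^2
      = (L.card : ℤ) * (Fintype.card F - L.card) := by
    have : ∀ y : F, (∑ x ∈ L, quadraticChar F (x - y))^2 =
        ∑ x ∈ L, ∑ x' ∈ L, quadraticChar F (x - y) * quadraticChar F (x' - y) := by
      intro y; rw [sq, Finset.sum_mul_sum]
    simp_rw [this]
    rw [Finset.sum_comm]
    have : ∀ x ∈ L, ∑ y : F, ∑ x' ∈ L, quadraticChar F (x - y) * quadraticChar F (x' - y)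
        = (Fintype.card F - L.card : ℤ) := by
      intro x hx
      rw [Finset.sum_comm, ← Finset.sum_erase_add _ _ hx, s15_sum_self]
      rw [Finset.sum_congr rfl (g := fun _ => (-1:ℤ))]
      · rw [Finset.sum_const, Finset.card_erase_of_mem hx]
        have : 1 ≤ L.card := by omega
        simp [Nat.cast_sub this]
      · intro x' hx'
        exact s15_sum_pair h2 x x' (Finset.ne_of_mem_erase hx').symm
    rw [Finset.sum_congr rfl this, Finset.sum_const, nsmul_eq_mul]
  have hle : ∑ y ∈ M, (∑ x ∈ L, quadraticChar F (x - y))^2 ≤ ∑ y : F, (∑ x ∈ L, quadraticChar F (x - y))^2 :=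
    Finset.sum_le_sum_of_subset_of_nonneg (Finset.subset_univ _) (fun _ _ _ => sq_nonneg _)
  rw [htot, Finset.sum_congr rfl hval, Finset.sum_const, nsmul_eq_mul] at hle
  have hLpos : (0:ℤ) < L.card := by exact_mod_cast (by omega : 0 < L.card)
  have h5 : (M.card : ℤ) * L.card ≤ Fintype.card F - L.card := by nlinarith
  have h6 : (L.card : ℤ) + M.card + ε = Fintype.card F := by exact_mod_cast (by omega : L.card + M.card + ε = Fintype.card F)
  have h7 : (2:ℤ) ≤ L.card := by exact_mod_cast hL2
  have h8 : (1:ℤ) ≤ M.card := by exact_mod_cast hM1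
  have h9 : (2:ℤ) * ε + 2 < Fintype.card F := by exact_mod_cast hε
  nlinarith [mul_nonneg (sub_nonneg.2 h7) (sub_nonneg.2 h8)]


lemma s15_root {F : Type*} [Field F] [Fintype F] (p : ℕ) [Fact p.Prime] [CharP F p] :
    ∀ (n : ℕ) (a b : F[X]), b.natDegree = n → 0 < n →
    ∃ (j : ℕ) (a1 b1 : F[X]), a = a1 ^ (p ^ j) ∧ b = b1 ^ (p ^ j) ∧
      ¬ (derivative a1 = 0 ∧ derivative b1 = 0) := by
  intro n
  induction n using Nat.strong_induction_on with
  | _ n ih =>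
    intro a b hb hn
    by_cases h : derivative a = 0 ∧ derivative b = 0
    · have hp : p.Prime := Fact.out
      have key : ∀ f : F[X], derivative f = 0 → ∃ g : F[X], f = g ^ p := by
        intro f hf
        refine ⟨(contract p f).map ((frobeniusEquiv F p).symm : F →+* F), ?_⟩
        rw [← polynomial_expand_eq F p (contract p f), expand_contract p hf hp.ne_zero]
      obtain ⟨a2, ha2⟩ := key a h.1
      obtain ⟨b2, hb2⟩ := key b h.2
      have hd : p * b2.natDegree = n := by rw [← hb, hb2, natDegree_pow]
      have hp2 := hp.two_le
      have h0 : 0 < b2.natDegree := by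
        rcases Nat.eq_zero_or_pos b2.natDegree with h0 | h0
        · rw [h0] at hd; omega
        · exact h0
      obtain ⟨j, a1, b1, h1, h3, h4⟩ := ih b2.natDegree (by nlinarith) a2 b2 rfl h0
      refine ⟨j + 1, a1, b1, ?_, ?_, h4⟩
      · rw [ha2, h1, ← pow_mul, pow_succ]
      · rw [hb2, h3, ← pow_mul, pow_succ]
    · exact ⟨0, a, b, by simp, by simp, h⟩

set_option maxHeartbeats 2000000 in
lemma s15_coreB {F : Type*} [Field F] [Fintype F] (p h : ℕ) [Fact p.Prime] [CharP F p]
    (hp2 : p ≠ 2) (e ε : ℕ) (hcard : Fintype.card F = p ^ h) (hqe : p ^ h = 2 * e + 1) 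
    (hε : (2 * ε + 1) ^ 2 < p ^ h) (H w : F[X]) (hH : H.Monic) (hHd : H.natDegree = e)
    (hw : Squarefree w) (hwd : w.natDegree ≤ ε) (hw1 : derivative w ≠ 0)
    (hw2 : derivative (derivative w) = 0)
    (heq : w * (H ^ 2 - 1) = (X ^ (p ^ h) - X) * derivative w) :
    ∃ u : F, H = (X - C u) ^ e := by
  have hp : p.Prime := Fact.out
  have hw0 : w ≠ 0 := hw.ne_zero
  have hHne : H ≠ 0 := hH.ne_zero
  set a0 := w - X * derivative w with ha0
  have ha0' : derivative a0 = 0 := by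
    simp [ha0, hw2]
  have hB : H ^ 2 * w = a0 + X ^ (p ^ h) * derivative w := by
    rw [ha0]; linear_combination heq
  have hwa : w = a0 + X * derivative w := by rw [ha0]; ring
  have hm : 0 < w.natDegree := by
    rcases Nat.eq_zero_or_pos w.natDegree with h0 | h0
    · exact absurd (derivative_of_natDegree_zero h0) hw1
    · exact h0
  have hdb : (derivative w).natDegree + 1 = w.natDegree := by
    have h1 : (H ^ 2 * w).natDegree = 2 * e + w.natDegree := by
      rw [natDegree_mul (pow_ne_zero _ hHne) hw0, natDegree_pow, hHd]
    have h2 : (X ^ (p ^ h) * derivative w).natDegree = p ^ h + (derivative w).natDegree := by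
      rw [natDegree_mul (pow_ne_zero _ X_ne_zero) hw1, natDegree_pow, natDegree_X, mul_one]
    have h3 : a0.natDegree ≤ w.natDegree := by
      rw [ha0]
      refine (natDegree_sub_le _ _).trans (max_le le_rfl ?_)
      rw [natDegree_mul X_ne_zero hw1, natDegree_X]
      have := natDegree_derivative_lt hm.ne'
      omega
    rw [hB, natDegree_add_eq_right_of_natDegree_lt, h2] at h1
    · omega
    · rw [h2]; nlinarith
  by_cases h1 : w.natDegree = 1
  · obtain ⟨c, u', hc, hwc⟩ : ∃ c u' : F, c ≠ 0 ∧ w = C c * X + C u' := by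
      obtain ⟨c, hc, u', hu⟩ := natDegree_eq_one.1 h1
      exact ⟨c, u', hc, hu.symm⟩
    refine ⟨- u' / c, ?_⟩
    have hwc' : w = C c * (X - C (-u'/c)) := by
      rw [hwc, mul_sub, ← C_mul, mul_div_cancel₀ _ hc]; simp
    have hdw : derivative w = C c := by rw [hwc]; simp
    have hCc : C c ≠ 0 := C_ne_zero.2 hc
    set u := -u'/c
    have hpow : (X - C u) ^ (p ^ h) = X ^ (p ^ h) - C u := by
      rw [sub_pow_char_pow, ← C_pow, ← hcard, FiniteField.pow_card]
    have h5 : H ^ 2 * (X - C u) = ((X - C u) ^ e) ^ 2 * (X - C u) := by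
      have : ((X - C u) ^ e) ^ 2 * (X - C u) = X ^ (p ^ h) - C u := by
        rw [← hpow, hqe]; ring
      rw [this]
      apply mul_left_cancel₀ hCc
      rw [hdw, hwc'] at heq
      linear_combination heq
    have h6 := mul_right_cancel₀ (X_sub_C_ne_zero u) h5
    rcases sq_eq_sq_iff_eq_or_eq_neg.1 h6 with h7 | h7
    · exact h7
    · exfalso
      have h8 : H.leadingCoeff = 1 := hH
      rw [h7, leadingCoeff_neg, ((monic_X_sub_C u).pow e).leadingCoeff] at h8
      have : (2:F) = 0 := by linear_combination -h8
      have h9 : ((2:ℕ) : F) = 0 := by exact_mod_cast this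
      rw [CharP.cast_eq_zero_iff F p] at h9
      exact hp2 ((Nat.prime_dvd_prime_iff_eq hp Nat.prime_two).1 h9)
  · exfalso
    obtain ⟨j, a, b, ha, hb, hab⟩ := s15_root p _ a0 (derivative w) rfl (by omega)
    have hj : j ≠ 0 := by
      rintro rfl
      simp only [pow_zero, pow_one] at ha hb
      exact hab ⟨ha ▸ ha0', hb ▸ hw2⟩
    set P := p ^ j with hP
    have hp3 : 3 ≤ p := by have := hp.two_le; omega
    have hP3 : 3 ≤ P := hp3.trans (Nat.le_self_pow hj p)
    have hPodd : Odd P := (hp.odd_of_ne_two hp2).pow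
    obtain ⟨r, hr⟩ := hPodd
    have hbne : b ≠ 0 := by
      rintro rfl
      rw [zero_pow (by omega)] at hb
      exact hw1 hb
    have hdeg : w.natDegree = 1 + P * b.natDegree := by
      rw [← hdb, hb, natDegree_pow]; ring
    have hβ : 0 < b.natDegree := by
      rcases Nat.eq_zero_or_pos b.natDegree with h0 | h0
      · rw [h0] at hdeg; omega
      · exact h0
    have hPβ : P ≤ P * b.natDegree := Nat.le_mul_of_pos_right _ hβ
    have hjh : j < h := by
      by_contra hjh
      have : p ^ h ≤ p ^ j := Nat.pow_le_pow_right hp.pos (by omega)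
      nlinarith
    set Q := p ^ (h - j) with hQ
    have hPQ : Q * P = p ^ h := by rw [hQ, hP, ← pow_add]; congr 1; omega
    have hQ0 : (Q : F[X]) = 0 := by
      rw [hQ, Nat.cast_pow, CharP.cast_eq_zero, zero_pow (by omega)]
    have hwab : w = a ^ P + X * b ^ P := by rw [← ha, ← hb]; exact hwa
    set M := a + X ^ Q * b with hM
    have hMP : M ^ P = H ^ 2 * w := by
      rw [hB, hM, hP, add_pow_char_pow, mul_pow, ← pow_mul, ← hP, ← ha, ← hb, hPQ]
    have hwM : w ∣ M := by
      rw [← hw.dvd_pow_iff_dvd (n := P) (by omega), hMP]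
      exact dvd_mul_left _ _
    obtain ⟨N, hN⟩ := hwM
    have hMne : M ≠ 0 := by
      intro h0
      rw [h0, zero_pow (by omega)] at hMP
      exact mul_ne_zero (pow_ne_zero _ hHne) hw0 hMP.symm
    have hMr : (M ^ r) ^ 2 * N = H ^ 2 := by
      apply mul_right_cancel₀ hw0
      rw [← hMP, hr]
      have : M ^ (2 * r + 1) = (M ^ r) ^ 2 * M := by ring
      rw [this]
      conv_rhs => rw [hN]
      rw [← hN]
      rw [mul_assoc, mul_comm N w, ← hN]
    have hdv : M ^ r ∣ H := (IsIntegrallyClosed.pow_dvd_pow_iff (two_ne_zero)).1 ⟨N, hMr.symm⟩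
    obtain ⟨N0, hN0⟩ := hdv
    have hNN : N = N0 ^ 2 := by
      apply mul_left_cancel₀ (pow_ne_zero 2 (pow_ne_zero r hMne))
      rw [hMr, hN0]; ring
    have hM' : derivative M = derivative a + X ^ Q * derivative b := by
      rw [hM]
      simp [derivative_mul, derivative_X_pow, hQ0]
    have hN0dvd : N0 ∣ derivative a * b - a * derivative b := by
      have h2 : derivative a * b - a * derivative b = derivative M * b - M * derivative b := by
        rw [hM', hM]; ring
      rw [h2]
      have h3 : N0 ∣ M := ⟨w * N0, by rw [hN, hNN]; ring⟩
      have h4 : N0 ∣ derivative M := by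
        rw [hN, hNN, derivative_mul, derivative_pow]
        refine dvd_add ⟨derivative w * N0, by ring⟩ ⟨w * (C 2 * derivative N0), ?_⟩
        simp; ring
      exact dvd_sub (h4.mul_right _) (h3.mul_right _)
    have hcop : IsCoprime a b := by
      apply IsRelPrime.isCoprime
      intro g hga hgb
      apply hw
      have h2 : g ^ P ∣ w := by
        rw [hwab]
        exact dvd_add (pow_dvd_pow_of_dvd hga P) ((pow_dvd_pow_of_dvd hgb P).mul_left _)
      rw [← sq]
      exact (pow_dvd_pow g (by omega)).trans h2
    have hne : derivative a * b - a * derivative b ≠ 0 := by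
      intro h0
      have h2 : b ∣ a * derivative b := ⟨derivative a, by linear_combination -h0⟩
      have h3 : b ∣ derivative b := hcop.symm.dvd_of_dvd_mul_left h2
      have h4 := dvd_derivative_iff.1 h3
      rw [h4, mul_zero, sub_zero] at h0
      exact hab ⟨(mul_eq_zero.1 h0).resolve_right hbne, h4⟩
    have hda : a.natDegree ≤ b.natDegree := by
      have h3 : a0.natDegree ≤ w.natDegree := by
        rw [ha0]
        refine (natDegree_sub_le _ _).trans (max_le le_rfl ?_)
        rw [natDegree_mul X_ne_zero hw1, natDegree_X]
        omega
      rw [ha, natDegree_pow, hdeg] at h3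
      by_contra h4
      have : P * (b.natDegree + 1) ≤ P * a.natDegree := Nat.mul_le_mul_left _ (by omega)
      nlinarith
    have hN0ne : N0 ≠ 0 := by
      rintro rfl
      rw [mul_zero] at hN0
      exact hHne hN0
    have hdN0 : N0.natDegree + 1 ≤ 2 * b.natDegree := by
      have h2 := natDegree_le_of_dvd hN0dvd hne
      have h3 : (derivative a * b - a * derivative b).natDegree ≤ 2 * b.natDegree - 1 := by
        have h5 := natDegree_derivative_le a
        have h6 := natDegree_derivative_le b
        refine (natDegree_sub_le _ _).trans (max_le ?_ ?_)
        · refine natDegree_mul_le.trans ?_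
          omega
        · refine natDegree_mul_le.trans ?_
          omega
      omega
    have hdM : P * M.natDegree = 2 * e + w.natDegree := by
      rw [← natDegree_pow, hMP, natDegree_mul (pow_ne_zero _ hHne) hw0, natDegree_pow, hHd]
    have hdM2 : M.natDegree = w.natDegree + 2 * N0.natDegree := by
      rw [hN, hNN, natDegree_mul hw0 (pow_ne_zero _ hN0ne), natDegree_pow]
    have h10 : P * M.natDegree = P * (Q + b.natDegree) := by
      rw [hdM, hdeg, mul_add, mul_comm P Q, hPQ]; omega
    have h11 : M.natDegree = Q + b.natDegree := Nat.eq_of_mul_eq_mul_left (by omega) h10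
    have h12 : Q + 1 ≤ (3 + P) * b.natDegree := by nlinarith
    have h13 : P * b.natDegree + 1 ≤ ε := by omega
    have h14 : P * (Q + 1) ≤ P * ((3 + P) * b.natDegree) := Nat.mul_le_mul_left _ h12
    have h15 : P * ((3 + P) * b.natDegree) = (3 + P) * (P * b.natDegree) := by ring
    have h16 : (3 + P) * (P * b.natDegree) ≤ (3 + ε) * ε := Nat.mul_le_mul (by omega) (by omega)
    have h17 : Q * P ≤ (3 + ε) * ε := by
      have : Q * P ≤ P * (Q + 1) := by rw [mul_add, mul_comm]; omega
      omega
    rw [hPQ] at h17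
    clear_value P Q
    have h18 : (3 + ε) * ε ≤ (2 * ε + 1) ^ 2 := by nlinarith
    omega

lemma s15_prod_univ {F : Type*} [Field F] [Fintype F] :
    ∏ u : F, (X - C u) = X ^ (Fintype.card F) - X := by
  have h1 : (X ^ (Fintype.card F) - X : F[X]).Monic := by
    apply monic_X_pow_sub
    rw [degree_X]; exact_mod_cast Fintype.one_lt_card
  have h2 := prod_multiset_X_sub_C_of_monic_of_roots_card_eq h1 (by
    rw [FiniteField.roots_X_pow_card_sub_X,
      FiniteField.X_pow_card_sub_X_natDegree_eq F Fintype.one_lt_card]; rfl)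
  rw [FiniteField.roots_X_pow_card_sub_X] at h2
  exact h2

lemma s15_core {F : Type*} [Field F] [Fintype F] (p h : ℕ) [Fact p.Prime] [CharP F p]
    (hp2 : p ≠ 2) (e ε : ℕ) (hcard : Fintype.card F = p ^ h) (hqe : p ^ h = 2 * e + 1) 
    (hε : (2 * ε + 1) ^ 2 < p ^ h) (hε1 : 1 ≤ ε) (S : Finset F) (hS : S.card + ε = p ^ h)
    (H : F[X]) (hH : H.Monic) (hHd : H.natDegree = e)
    (hHS : ∀ u ∈ S, H.eval u ^ 2 = 1) :
    ∃ u : F, H = (X - C u) ^ e := by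
  classical
  have he : 2 * ε + 1 < e := by nlinarith
  set T := ∏ u ∈ S, (X - C u) with hT
  set w := ∏ u ∈ Sᶜ, (X - C u) with hw
  have hTm : T.Monic := monic_prod_of_monic _ _ (fun u _ => monic_X_sub_C u)
  have hwm : w.Monic := monic_prod_of_monic _ _ (fun u _ => monic_X_sub_C u)
  have hTd : T.natDegree = S.card := by
    rw [hT, natDegree_prod_of_monic _ _ (fun u _ => monic_X_sub_C u)]; simp
  have hwd : w.natDegree = ε := by
    rw [hw, natDegree_prod_of_monic _ _ (fun u _ => monic_X_sub_C u)]
    simp [Finset.card_compl, hcard]; omega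
  have hTw : T * w = X ^ (p ^ h) - X := by
    rw [hT, hw, Finset.prod_mul_prod_compl, s15_prod_univ, hcard]
  have hh : h ≠ 0 := by rintro rfl; simp at hε
  have hder : derivative T * w + T * derivative w = -1 := by
    rw [← derivative_mul, hTw]
    have : ((p:F)) = 0 := CharP.cast_eq_zero F p
    simp [derivative_X_pow, this, hh]
  have hdvd : T ∣ H ^ 2 - 1 := by
    apply Finset.prod_dvd_of_coprime
    · intro a _ b _ hab
      exact pairwise_coprime_X_sub_C Function.injective_id hab
    · intro u hu
      rw [dvd_iff_isRoot, IsRoot.def]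
      simp [hHS u hu]
  obtain ⟨v, hv⟩ := hdvd
  have hH2 : (H ^ 2 - 1).natDegree = 2 * e := by
    rw [natDegree_sub_eq_left_of_natDegree_lt, natDegree_pow, hHd]
    rw [natDegree_pow, hHd, natDegree_one]; omega
  have hv0 : v ≠ 0 := by
    rintro rfl
    rw [mul_zero] at hv
    rw [hv, natDegree_zero] at hH2; omega
  have hvd : v.natDegree + 1 = ε := by
    rw [hv, natDegree_mul hTm.ne_zero hv0, hTd] at hH2; omega
  have hder2 : 2 * H * derivative H = derivative T * v + T * derivative v := by
    rw [← derivative_mul, ← hv]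
    rw [sq, derivative_sub, derivative_mul, derivative_one]; ring
  have hR : v ^ 2 + w * derivative v - v * derivative w = 0 := by
    apply eq_zero_of_dvd_of_natDegree_lt (p := H)
    · refine ⟨H * (w * derivative v - v * derivative w) - 2 * derivative H * w * v, ?_⟩
      linear_combination (w*v) * hder2 + v^2*hder - (w * derivative v - v * derivative w) * hv
    · rw [hHd]
      refine lt_of_le_of_lt (natDegree_sub_le _ _) (max_lt (lt_of_le_of_lt (natDegree_add_le _ _) (max_lt ?_ ?_)) ?_)
      · rw [natDegree_pow]; omega
      · refine lt_of_le_of_lt natDegree_mul_le ?_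
        have := natDegree_derivative_le v
        omega
      · refine lt_of_le_of_lt natDegree_mul_le ?_
        have := natDegree_derivative_le w
        omega
  set d := EuclideanDomain.gcd w v with hd
  have hd0 : d ≠ 0 := by
    rw [hd, Ne, EuclideanDomain.gcd_eq_zero_iff]
    exact fun h => hv0 h.2
  obtain ⟨w0, hw0⟩ : d ∣ w := EuclideanDomain.gcd_dvd_left _ _
  obtain ⟨v0, hv0'⟩ : d ∣ v := EuclideanDomain.gcd_dvd_right _ _
  have hcop : IsCoprime w0 v0 := by
    refine ⟨EuclideanDomain.gcdA w v, EuclideanDomain.gcdB w v, ?_⟩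
    apply mul_left_cancel₀ hd0
    have := EuclideanDomain.gcd_eq_gcd_ab w v
    rw [← hd] at this
    rw [mul_one]
    linear_combination - this - EuclideanDomain.gcdA w v * hw0 - EuclideanDomain.gcdB w v * hv0'
  have hv0ne : v0 ≠ 0 := by rintro rfl; rw [mul_zero] at hv0'; exact hv0 hv0'
  have hR0 : v0 ^ 2 + w0 * derivative v0 - v0 * derivative w0 = 0 := by
    apply mul_left_cancel₀ (pow_ne_zero 2 hd0)
    rw [mul_zero, ← hR]
    rw [hw0, hv0', derivative_mul, derivative_mul]
    ring
  have h1 : v0 ∣ derivative v0 := by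
    apply hcop.symm.dvd_of_dvd_mul_left
    exact ⟨derivative w0 - v0, by linear_combination hR0⟩
  have h2 := dvd_derivative_iff.1 h1
  have h3 : v0 = derivative w0 := by
    apply mul_left_cancel₀ hv0ne
    rw [h2] at hR0
    linear_combination hR0
  have hsep : w.Separable := by
    rw [hw]
    exact separable_prod_X_sub_C_iff'.2 (fun x _ y _ h => h)
  apply s15_coreB p h hp2 e ε hcard hqe hε H w0 hH hHd
  · exact hsep.squarefree.squarefree_of_dvd ⟨d, by rw [hw0]; ring⟩
  · rw [← hwd]
    exact natDegree_le_of_dvd ⟨d, by rw [hw0]; ring⟩ hwm.ne_zero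
  · rw [← h3]; exact hv0ne
  · rw [← h3]; exact h2
  · apply mul_left_cancel₀ hd0
    rw [← h3]
    linear_combination (-(H^2-1)) * hw0 + w * hv + v * hTw + (X ^ p ^ h - X) * hv0'

lemma s15_lagr {F : Type*} [Field F] [DecidableEq F] (C : Finset F) (y : F) (g : F[X])
    (hg : g.degree < C.card) :
    ∑ y0 ∈ C, eval y (Lagrange.basis C id y0) * g.eval y0 = g.eval y := by
  have h1 := Lagrange.eq_interpolate (s := C) (v := id) (fun x _ y _ h => h) hg
  conv_rhs => rw [h1]
  rw [Lagrange.interpolate_apply, eval_finsetSum]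
  refine Finset.sum_congr rfl (fun i _ => ?_)
  simp [mul_comm]

lemma s15_extend {F : Type*} [Field F] [Fintype F] (p h : ℕ) [Fact p.Prime] [CharP F p]
    (hp2 : p ≠ 2) (e ε : ℕ) (hcard : Fintype.card F = p ^ h) (hqe : p ^ h = 2 * e + 1) 
    (hε : (2 * ε + 1) ^ 2 < p ^ h) (Cs : Finset F) (hC : Cs.card + ε = p ^ h)
    (φ : F → F) (hinj : Set.InjOn φ Cs)
    (hφ : ∀ x ∈ Cs, ∀ y ∈ Cs, (φ x - φ y) ^ e = (x - y) ^ e) :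
    ∃ ψ : F → F, (∀ x ∈ Cs, ψ x = φ x) ∧ ∀ x y, (ψ x - ψ y) ^ e = (x - y) ^ e := by
  classical
  rcases Nat.eq_zero_or_pos ε with h0 | hε1
  · have hu : ∀ x, x ∈ Cs := by
      have : Cs = Finset.univ := by
        rw [← Finset.card_eq_iff_eq_univ]; omega
      intro x; rw [this]; exact Finset.mem_univ x
    exact ⟨φ, fun _ _ => rfl, fun x y => hφ x (hu x) y (hu y)⟩
  have hec : e < Cs.card := by nlinarith
  have he0 : e ≠ 0 := by rintro rfl; nlinarith
  have hpar : ∀ x y y0 : F, ∑ y0 ∈ Cs, eval y (Lagrange.basis Cs id y0) * (x - y0) ^ e = (x - y) ^ e := by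
    intro x y y0
    have h1 := s15_lagr Cs y ((C x - X) ^ e) (by
      refine lt_of_le_of_lt degree_le_natDegree ?_
      have h2 : ((C x - X) ^ e).natDegree ≤ e := by
        refine natDegree_pow_le.trans ?_
        have : (C x - X : F[X]).natDegree ≤ 1 := by
          refine (natDegree_sub_le _ _).trans ?_
          simp
        nlinarith
      exact_mod_cast lt_of_le_of_lt h2 hec)
    simpa using h1
  have hone : ∀ y : F, ∑ y0 ∈ Cs, eval y (Lagrange.basis Cs id y0) = 1 := by
    intro y
    have h1 := s15_lagr Cs y 1 (by
      rw [degree_one]; exact_mod_cast (by omega : 0 < Cs.card))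
    simpa using h1
  have hex : ∀ y : F, y ∉ Cs → ∃ u : F, 
      ∑ y0 ∈ Cs, C (eval y (Lagrange.basis Cs id y0)) * (X - C (φ y0)) ^ e = (X - C u) ^ e := by
    intro y hy
    have hHd : (∑ y0 ∈ Cs, C (eval y (Lagrange.basis Cs id y0)) * (X - C (φ y0)) ^ e).natDegree ≤ e := by
      apply natDegree_sum_le_of_forall_le
      intro i _
      refine natDegree_C_mul_le _ _ |>.trans ?_
      rw [natDegree_pow, natDegree_X_sub_C, mul_one]
    have hHc : (∑ y0 ∈ Cs, C (eval y (Lagrange.basis Cs id y0)) * (X - C (φ y0)) ^ e).coeff e = 1 := by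
      rw [finsetSum_coeff, ← hone y]
      refine Finset.sum_congr rfl (fun i _ => ?_)
      have h3 : ((X - C (φ i)) ^ e).coeff e = 1 := by
        have := ((monic_X_sub_C (φ i)).pow e).coeff_natDegree
        rwa [natDegree_pow, natDegree_X_sub_C, mul_one] at this
      rw [coeff_C_mul, h3, mul_one]
    refine s15_core p h hp2 e ε hcard hqe hε hε1 (Cs.image φ) ?_ _ 
      (monic_of_natDegree_le_of_coeff_eq_one e hHd hHc) ?_ ?_
    · rw [Finset.card_image_of_injOn hinj, hC]
    · exact natDegree_eq_of_le_of_coeff_ne_zero hHd (by rw [hHc]; exact one_ne_zero)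
    · intro u hu
      obtain ⟨x, hx, rfl⟩ := Finset.mem_image.1 hu
      have h4 : eval (φ x) (∑ y0 ∈ Cs, C (eval y (Lagrange.basis Cs id y0)) * (X - C (φ y0)) ^ e) = (x - y) ^ e := by
        rw [← hpar x y y, eval_finsetSum]
        refine Finset.sum_congr rfl (fun i hi => ?_)
        simp [hφ x hx i hi]
      rw [h4, ← pow_mul]
      have : e * 2 = Fintype.card F - 1 := by omega
      rw [this]
      exact FiniteField.pow_card_sub_one_eq_one _ (sub_ne_zero.2 (by rintro rfl; exact hy hx))
  choose! u hu using hex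
  have hu' : ∀ y, y ∉ Cs → ∀ x, (x - u y) ^ e = ∑ y0 ∈ Cs, eval y (Lagrange.basis Cs id y0) * (x - φ y0) ^ e := by
    intro y hy x
    have := congrArg (eval x) (hu y hy)
    rw [eval_finsetSum] at this
    simp only [eval_mul, eval_C, eval_pow, eval_sub, eval_X] at this
    exact this.symm
  have h1 : ∀ x ∈ Cs, ∀ y, y ∉ Cs → (φ x - u y) ^ e = (x - y) ^ e := by
    intro x hx y hy
    rw [hu' y hy, ← hpar x y y]
    exact Finset.sum_congr rfl (fun i hi => by rw [hφ x hx i hi])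
  have h2 : ∀ x, x ∉ Cs → ∀ y ∈ Cs, (u x - φ y) ^ e = (x - y) ^ e := by
    intro x hx y hy
    rw [← neg_sub (φ y), neg_pow, h1 y hy x hx, ← neg_pow, neg_sub]
  refine ⟨fun x => if x ∈ Cs then φ x else u x, fun x hx => by simp [hx], ?_⟩
  intro x y
  by_cases hx : x ∈ Cs <;> by_cases hy : y ∈ Cs <;> simp only [hx, hy, if_true, if_false]
  · exact hφ x hx y hy
  · exact h1 x hx y hy
  · exact h2 x hx y hy
  · rw [hu' y hy, ← hpar x y y]
    exact Finset.sum_congr rfl (fun i hi => by rw [h2 x hx i hi])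

lemma s15_poly_ext {F : Type*} [Field F] [Fintype F] (f g : F[X])
    (hf : f.natDegree < Fintype.card F) (hg : g.natDegree < Fintype.card F)
    (h : ∀ x, f.eval x = g.eval x) : f = g := by
  rw [← sub_eq_zero]
  apply eq_zero_of_natDegree_lt_card_of_eval_eq_zero _ (Function.injective_id (α := F))
  · intro x; simp [h]
  · exact lt_of_le_of_lt (natDegree_sub_le _ _) (max_lt hf hg)

lemma s15_carA {F : Type*} [Field F] [Fintype F] (p : ℕ) [Fact p.Prime] [CharP F p]
    (hp2 : p ≠ 2) (e : ℕ) (hqe : Fintype.card F = 2 * e + 1) (he2 : 2 ≤ e)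
    (φ : F → F) (hφ : ∀ x y, (φ x - φ y) ^ e = (x - y) ^ e) (j : ℕ) (hj : 1 ≤ j) :
    ∃ G : F[X], G.natDegree ≤ e - 1 ∧ ∀ x, G.eval x = (- φ x) ^ (e - j) * (e.choose j : F) := by
  classical
  have hinj : Function.Injective φ := by
    intro x y hxy
    have := hφ x y
    rw [hxy, sub_self, zero_pow (by omega)] at this
    exact sub_eq_zero.1 (pow_eq_zero_iff (by omega) |>.1 this.symm)
  have hco : ∀ g : F[X], g.natDegree ≤ e → g.coeff j = ∑ y : F, g.eval (φ y) * (Lagrange.basis Finset.univ φ y).coeff j := by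
    intro g hg
    have h1 := Lagrange.eq_interpolate (s := Finset.univ) (v := φ) (hinj.injOn) (f := g) (by
      refine lt_of_le_of_lt degree_le_natDegree ?_
      rw [Finset.card_univ]
      exact_mod_cast (by omega : g.natDegree < Fintype.card F))
    conv_lhs => rw [h1]
    rw [Lagrange.interpolate_apply, finsetSum_coeff]
    exact Finset.sum_congr rfl (fun i _ => by rw [coeff_C_mul])
  refine ⟨∑ y : F, C ((Lagrange.basis Finset.univ φ y).coeff j) * (C y - X) ^ e, ?_, ?_⟩
  · have hd : ∀ y : F, ((C y - X) ^ e : F[X]).natDegree ≤ e := by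
      intro y
      refine natDegree_pow_le.trans ?_
      have : (C y - X : F[X]).natDegree ≤ 1 := by
        refine (natDegree_sub_le _ _).trans ?_
        simp
      nlinarith
    have hle : (∑ y : F, C ((Lagrange.basis Finset.univ φ y).coeff j) * (C y - X) ^ e).natDegree ≤ e := by
      apply natDegree_sum_le_of_forall_le
      intro i _
      exact (natDegree_C_mul_le _ _).trans (hd i)
    have hc : (∑ y : F, C ((Lagrange.basis Finset.univ φ y).coeff j) * (C y - X) ^ e).coeff e = 0 := by
      rw [finsetSum_coeff]
      have h3 : ∀ y : F, ((C y - X) ^ e : F[X]).coeff e = (-1) ^ e := by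
        intro y
        have h4 : (C y - X : F[X]) ^ e = C ((-1) ^ e) * (X - C y) ^ e := by
          rw [← neg_sub X, neg_pow]; simp
        have := ((monic_X_sub_C y).pow e).coeff_natDegree
        rw [natDegree_pow, natDegree_X_sub_C, mul_one] at this
        rw [h4, coeff_C_mul, this, mul_one]
      simp_rw [coeff_C_mul, h3]
      rw [← Finset.sum_mul]
      have h5 := hco 1 (by simp)
      simp only [eval_one, one_mul] at h5
      rw [← h5, coeff_one, if_neg (by omega), zero_mul]
    by_contra hcon
    have h6 : (∑ y : F, C ((Lagrange.basis Finset.univ φ y).coeff j) * (C y - X) ^ e).natDegree = e := by omega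
    have h7 : (∑ y : F, C ((Lagrange.basis Finset.univ φ y).coeff j) * (C y - X) ^ e) = 0 := by
      rw [← leadingCoeff_eq_zero, ← coeff_natDegree, h6]; exact hc
    rw [h7, natDegree_zero] at h6
    omega
  · intro x
    have h8 := hco ((X + C (- φ x)) ^ e) (by rw [natDegree_pow, natDegree_X_add_C, mul_one])
    rw [coeff_X_add_C_pow] at h8
    rw [h8, eval_finsetSum]
    refine Finset.sum_congr rfl (fun y _ => ?_)
    simp only [eval_mul, eval_C, eval_pow, eval_sub, eval_X, eval_add]
    rw [← hφ y x]; ring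

lemma s15_carB {F : Type*} [Field F] [Fintype F] (p : ℕ) [Fact p.Prime] [CharP F p]
    (hp2 : p ≠ 2) (e : ℕ) (hqe : Fintype.card F = 2 * e + 1) (he2 : 2 ≤ e)
    (φ : F → F) (hφ : ∀ x y, (φ x - φ y) ^ e = (x - y) ^ e) (v : F) :
    ∃ (α : F) (D : ℕ), D ≤ e - 1 ∧ ∀ x, φ x = φ v + α * (x - v) ^ D := by
  have hφv : ∀ x y, ((φ x - φ v) - (φ y - φ v)) ^ e = (x - y) ^ e := by
    intro x y; rw [← hφ x y]; congr 1; ring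
  obtain ⟨A, hA1, hA2⟩ := s15_carA p hp2 e hqe he2 (fun x => φ x - φ v) hφv (e - 1) (by omega)
  obtain ⟨B, hB1, hB2⟩ := s15_carA p hp2 e hqe he2 (fun x => φ x - φ v) hφv 1 (by omega)
  have he0 : (e : F) ≠ 0 := by
    intro h0
    have h1 : ((Fintype.card F : ℕ) : F) = 0 := FiniteField.cast_card_eq_zero F
    rw [hqe] at h1
    push_cast at h1
    rw [h0] at h1
    simp at h1
  have hc1 : e.choose (e - 1) = e := by
    rw [Nat.choose_symm_of_eq_add (show e = (e-1) + 1 by omega), Nat.choose_one_right]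
  simp only [hc1, Nat.choose_one_right] at hA2 hB2
  have hAB : A * B = C ((e:F)^2 * (-1) ^ e) * (X - C v) ^ e := by
    apply s15_poly_ext
    · refine lt_of_le_of_lt natDegree_mul_le ?_; omega
    · refine lt_of_le_of_lt (natDegree_C_mul_le _ _) ?_
      rw [natDegree_pow, natDegree_X_sub_C]; omega
    · intro x
      simp only [eval_mul, eval_C, eval_pow, eval_sub, eval_X, hA2, hB2, ← hφ x v]
      have h1 : e - (e - 1) = 1 := by omega
      rw [h1]
      have h2 : (-(φ x - φ v)) ^ 1 * (-(φ x - φ v)) ^ (e - 1) = (-1) ^ e * (φ x - φ v) ^ e := by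
        rw [← pow_add, ← neg_pow]; congr 1; omega
      linear_combination (e:F)^2 * h2
  have hu : IsUnit (C ((e:F)^2 * (-1) ^ e)) := by
    rw [isUnit_C, isUnit_iff_ne_zero]
    exact mul_ne_zero (pow_ne_zero _ he0) (pow_ne_zero _ (by simp))
  have hdvd : A ∣ (X - C v) ^ e := by
    have : A ∣ C ((e:F)^2 * (-1) ^ e) * (X - C v) ^ e := ⟨B, hAB.symm⟩
    rwa [hu.dvd_mul_left] at this
  obtain ⟨D, hD, hass⟩ := (dvd_prime_pow (prime_X_sub_C v) e).1 hdvd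
  obtain ⟨un, hun⟩ := hass.symm
  obtain ⟨c, hc, hcu⟩ := isUnit_iff.1 un.isUnit
  have hc0 : c ≠ 0 := hc.ne_zero
  refine ⟨- c / e, D, ?_, ?_⟩
  · rw [← hun, ← hcu, natDegree_mul (pow_ne_zero _ (X_sub_C_ne_zero v)) (C_ne_zero.2 hc0),
      natDegree_pow, natDegree_X_sub_C, natDegree_C] at hA1
    omega
  · intro x
    have h1 := hA2 x
    have h2 : e - (e - 1) = 1 := by omega
    rw [← hun, ← hcu, h2] at h1
    simp only [eval_mul, eval_C, eval_pow, eval_sub, eval_X, pow_one] at h1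
    field_simp
    linear_combination h1

lemma s15_carlitz {F : Type*} [Field F] [Fintype F] (p : ℕ) [Fact p.Prime] [CharP F p]
    (hp2 : p ≠ 2) (e : ℕ) (hqe : Fintype.card F = 2 * e + 1) (he2 : 2 ≤ e)
    (φ : F → F) (hφ : ∀ x y, (φ x - φ y) ^ e = (x - y) ^ e) :
    ∃ (α γ : F) (k : ℕ), p ^ k < Fintype.card F ∧ ∀ x, φ x = γ + α * x ^ (p ^ k) := by
  obtain ⟨α, D, hD, h0⟩ := s15_carB p hp2 e hqe he2 φ hφ 0
  obtain ⟨α1, D1, hD1, h1⟩ := s15_carB p hp2 e hqe he2 φ hφ 1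
  have hne : φ 0 ≠ φ 1 := by
    intro hxy
    have := hφ 0 1
    rw [hxy, sub_self, zero_pow (by omega)] at this
    exact pow_ne_zero e (by simp) this.symm
  have hα : α ≠ 0 := by
    rintro rfl
    have := h0 1
    simp at this; exact hne this.symm
  have hα1 : α1 ≠ 0 := by
    rintro rfl
    have := h1 0
    simp at this; exact hne this
  have hDp : D ≠ 0 := by
    rintro rfl
    have h2 := h0 1
    have h3 := h0 0
    simp at h2 h3
    exact hα h3
  have hid : C α * X ^ D + C (φ 0 - φ 1) = C α1 * (X - C 1) ^ D1 := by
    apply s15_poly_ext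
    · rw [natDegree_add_C]
      refine lt_of_le_of_lt (natDegree_C_mul_le _ _) ?_
      rw [natDegree_pow, natDegree_X]; omega
    · refine lt_of_le_of_lt (natDegree_C_mul_le _ _) ?_
      rw [natDegree_pow, natDegree_X_sub_C]; omega
    · intro x
      have h2 := h0 x
      have h3 := h1 x
      simp only [eval_mul, eval_C, eval_pow, eval_sub, eval_X, eval_add]
      rw [sub_zero] at h2
      linear_combination h3 - h2
  have hDD : D = D1 := by
    have := congrArg natDegree hid
    rw [natDegree_add_C, natDegree_C_mul hα, natDegree_C_mul hα1, natDegree_pow, natDegree_pow,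
      natDegree_X, natDegree_X_sub_C] at this
    omega
  subst hDD
  have hp : p.Prime := Fact.out
  obtain ⟨k, m, hm, hDm⟩ := Nat.exists_eq_pow_mul_and_not_dvd hDp p hp.ne_one
  have hid2 : C α * X ^ m + C (φ 0 - φ 1) = C α1 * (X - C 1) ^ m := by
    apply expand_injective (pow_pos hp.pos k)
    have h5 : (X ^ (p ^ k) - C 1 : F[X]) = (X - C 1) ^ (p ^ k) := by
      rw [sub_pow_char_pow]; simp
    simp only [map_add, map_mul, expand_C, map_pow, expand_X, map_sub]
    rw [h5, ← pow_mul, ← pow_mul, ← hDm]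
    rw [← C_sub]
    exact hid
  have hm1 : m = 1 := by
    by_contra hm1
    have hm0 : m ≠ 0 := by rintro rfl; simp at hm
    have hder := congrArg (fun f => eval 0 (derivative f)) hid2
    simp [derivative_pow] at hder
    rw [zero_pow (by omega)] at hder
    simp [hα1] at hder
    rw [CharP.cast_eq_zero_iff F p] at hder
    exact hm hder
  rw [hm1, mul_one] at hDm
  refine ⟨α, φ 0, k, by omega, ?_⟩
  intro x
  have := h0 x
  rwa [sub_zero, hDm] at this

lemma s15_slice {F : Type*} [Field F] [Fintype F] (p h : ℕ) [Fact p.Prime] [CharP F p]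
    (hp2 : p ≠ 2) (hcard : Fintype.card F = p ^ h) (hq : 9 < p ^ h) (ε : ℕ)
    (hε : (2 * ε + 1) ^ 2 < p ^ h) (Cs : Finset F) (hC : Cs.card + ε = p ^ h)
    (φ : F → F)
    (hsq : ∀ x ∈ Cs, ∀ y ∈ Cs, IsSquare ((φ x - φ y) * (x - y))) :
    ∃ (α γ : F) (k : ℕ), p ^ k < p ^ h ∧ IsSquare α ∧ ∀ x ∈ Cs, φ x = γ + α * x ^ (p ^ k) := by
  have hp : p.Prime := Fact.out
  have hpo : Odd p := hp.odd_of_ne_two hp2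
  obtain ⟨e, he⟩ : Odd (p ^ h) := hpo.pow
  have hrc : ringChar F ≠ 2 := by rw [ringChar.eq F p]; exact hp2
  rcases s15_inj_or_const hrc Cs φ ε (by rw [hcard, hC]) (by rw [hcard]; nlinarith) hsq with hinj | ⟨γ, hγ⟩
  swap
  · exact ⟨0, γ, 0, by simp; omega, IsSquare.zero, fun x hx => by simp [hγ x hx]⟩
  have hφ : ∀ x ∈ Cs, ∀ y ∈ Cs, (φ x - φ y) ^ e = (x - y) ^ e := by
    intro x hx y hy
    by_cases hxy : x = y
    · rw [hxy, sub_self, sub_self]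
    have h1 : x - y ≠ 0 := sub_ne_zero.2 hxy
    have h2 : φ x - φ y ≠ 0 := sub_ne_zero.2 (fun h => hxy (hinj hx hy h))
    have h3 := (FiniteField.isSquare_iff hrc (mul_ne_zero h2 h1)).1 (hsq x hx y hy)
    have h4 : Fintype.card F / 2 = e := by omega
    rw [h4, mul_pow] at h3
    have h5 : ((x - y) ^ e) ^ 2 = 1 := by
      rw [← pow_mul]
      have : e * 2 = Fintype.card F - 1 := by omega
      rw [this]
      exact FiniteField.pow_card_sub_one_eq_one _ h1
    linear_combination (x - y) ^ e * h3 - (φ x - φ y) ^ e * h5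
  obtain ⟨ψ, hψ1, hψ2⟩ := s15_extend p h hp2 e ε hcard he hε Cs hC φ hinj hφ
  obtain ⟨α, γ, k, hk, hk2⟩ := s15_carlitz p hp2 e (by omega) (by omega) ψ hψ2
  refine ⟨α, γ, k, by omega, ?_, fun x hx => by rw [← hψ1 x hx, hk2]⟩
  have : 1 < Cs.card := by nlinarith
  obtain ⟨x, hx, y, hy, hxy⟩ := Finset.one_lt_card.1 this
  have h1 := hsq x hx y hy
  have h0 : x - y ≠ 0 := sub_ne_zero.2 hxy
  rw [← hψ1 x hx, ← hψ1 y hy, hk2, hk2] at h1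
  obtain ⟨s, hs⟩ : Odd (p ^ k) := hpo.pow
  have h2 : (γ + α * x ^ p ^ k - (γ + α * y ^ p ^ k)) * (x - y) = α * ((x - y) ^ (s + 1)) ^ 2 := by
    have h3 : ((x - y) ^ (s + 1)) ^ 2 = (x - y) ^ (p ^ k) * (x - y) := by rw [hs]; ring
    rw [h3, sub_pow_char_pow]; ring
  rw [h2] at h1
  obtain ⟨r, hr⟩ := h1
  refine ⟨r / (x - y) ^ (s + 1), ?_⟩
  field_simp
  rw [hr]; ring

lemma s15_sqcount {F : Type*} [Field F] [Fintype F] (h2 : ringChar F ≠ 2) (T : Finset F)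
    (hT : ∀ x ∈ T, IsSquare x) : 2 * T.card ≤ Fintype.card F + 1 := by
  classical
  have h0 : ∑ w : F, quadraticChar F w = 0 := quadraticChar_sum_zero h2
  rw [← Finset.sum_add_sum_compl T] at h0
  have h1 : (T.card : ℤ) - 1 ≤ ∑ w ∈ T, quadraticChar F w := by
    have h3 : ∑ w ∈ T.erase 0, quadraticChar F w = ∑ w ∈ T, quadraticChar F w := by
      apply Finset.sum_subset (Finset.erase_subset _ _)
      intro x hx hx'
      have : x = 0 := by
        by_contra hne
        exact hx' (Finset.mem_erase.2 ⟨hne, hx⟩)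
      rw [this, quadraticChar_zero]
    rw [← h3, Finset.sum_congr rfl (g := fun _ => (1:ℤ))]
    · rw [Finset.sum_const, nsmul_eq_mul, mul_one]
      have := Finset.pred_card_le_card_erase (s := T) (a := 0)
      have : (T.card : ℤ) ≤ (T.erase 0).card + 1 := by exact_mod_cast (by omega)
      linarith
    · intro x hx
      exact (quadraticChar_one_iff_isSquare (Finset.ne_of_mem_erase hx)).2 (hT x (Finset.mem_of_mem_erase hx))
  have h4 : - ((Tᶜ).card : ℤ) ≤ ∑ w ∈ Tᶜ, quadraticChar F w := by
    have : ∑ w ∈ Tᶜ, (-1 : ℤ) ≤ ∑ w ∈ Tᶜ, quadraticChar F w := by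
      apply Finset.sum_le_sum
      intro x _
      by_cases hx : x = 0
      · rw [hx, quadraticChar_zero]; norm_num
      · rcases quadraticChar_dichotomy hx with h | h <;> rw [h]
        norm_num
    simpa using this
  have h5 : T.card + (Tᶜ).card = Fintype.card F := Finset.card_add_card_compl T
  have h6 : (T.card : ℤ) + (Tᶜ).card = Fintype.card F := by exact_mod_cast h5
  have h7 : (2:ℤ) * T.card ≤ Fintype.card F + 1 := by linarith
  exact_mod_cast h7

lemma s15_haszero {F : Type*} [Field F] [Fintype F] (p h k : ℕ) [Fact p.Prime] [CharP F p]
    (hp2 : p ≠ 2) (hcard : Fintype.card F = p ^ h) (hk1 : 1 ≤ k) (hkh : k < h)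
    (α ν d : F) (hα : α ≠ 0)
    (hsq : ∀ t, IsSquare (d + 4 * t * (ν + α * t ^ (p ^ k)))) :
    ∃ z, d + 4 * z * (ν + α * z ^ (p ^ k)) = 0 := by
  by_contra hcon
  push Not at hcon
  have hp : p.Prime := Fact.out
  have hrc : ringChar F ≠ 2 := by rw [ringChar.eq F p]; exact hp2
  have h2ne : (2:F) ≠ 0 := Ring.two_ne_zero hrc
  have h4ne : (4:F) ≠ 0 := by
    have : (4:F) = 2 * 2 := by norm_num
    rw [this]; exact mul_ne_zero h2ne h2ne
  obtain ⟨r, hr⟩ := hp.odd_of_ne_two hp2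
  have hr1 : 1 ≤ r := by have := hp.two_le; omega
  set g : ℕ → ℕ := fun i => if i + k < h then i + k else i + k - h with hg
  set f : ℕ → F[X] := fun i => C ((4 * α) ^ (p ^ i)) * X ^ (p ^ i + p ^ (g i)) +
    (C ((4 * ν) ^ (p ^ i)) * X ^ (p ^ i) + C (d ^ (p ^ i))) with hf
  have hev : ∀ t, ∀ i ∈ Finset.range h, (f i).eval t = (d + 4 * t * (ν + α * t ^ (p ^ k))) ^ (p ^ i) := by
    intro t i hi
    have hi' := Finset.mem_range.1 hi
    have h1 : t ^ (p ^ (g i)) = (t ^ (p ^ k)) ^ (p ^ i) := by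
      rw [← pow_mul, ← pow_add]
      simp only [hg]
      split_ifs with h3
      · rw [add_comm]
      · have h4 : k + i = h + (i + k - h) := by omega
        rw [h4, pow_add, pow_mul, ← hcard, FiniteField.pow_card]
    simp only [hf, eval_add, eval_mul, eval_C, eval_pow, eval_X]
    have h2 : d + 4 * t * (ν + α * t ^ (p ^ k)) = (4 * α) * (t * t ^ (p ^ k)) + ((4 * ν) * t + d) := by ring
    rw [h2, add_pow_char_pow, add_pow_char_pow, mul_pow (4 * α), mul_pow (4 * ν) t, mul_pow t, ← h1, pow_add]
  have hdeg : ∀ i, (f i).natDegree = p ^ i + p ^ (g i) := by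
    intro i
    have hpp : 0 < p ^ (g i) := pow_pos hp.pos _
    have h1 : (C ((4 * α) ^ (p ^ i)) * X ^ (p ^ i + p ^ (g i))).natDegree = p ^ i + p ^ (g i) :=
      natDegree_C_mul_X_pow _ _ (pow_ne_zero _ (mul_ne_zero h4ne hα))
    simp only [hf]
    rw [natDegree_add_eq_left_of_natDegree_lt, h1]
    rw [h1, natDegree_add_C]
    refine lt_of_le_of_lt (natDegree_C_mul_X_pow_le _ _) ?_
    omega
  have hfne : ∀ i, f i ≠ 0 := by
    intro i h0
    have := hdeg i
    rw [h0, natDegree_zero] at this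
    have hpp : 0 < p ^ (g i) := pow_pos hp.pos _
    omega
  have hgs : ∑ i ∈ Finset.range h, p ^ (g i) = ∑ i ∈ Finset.range h, p ^ i := by
    refine Finset.sum_nbij' g (fun j => if k ≤ j then j - k else j + h - k) ?_ ?_ ?_ ?_ ?_
    · intro i hi; simp only [hg, Finset.mem_range] at *; split_ifs <;> omega
    · intro i hi; simp only [Finset.mem_range] at *; split_ifs <;> omega
    · intro i hi; simp only [hg, Finset.mem_range] at *; split_ifs <;> omega
    · intro i hi; simp only [hg, Finset.mem_range] at *; split_ifs <;> omega
    · intro i _; rfl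
  have hgeo : (p - 1) * ∑ i ∈ Finset.range h, p ^ i + 1 = p ^ h := by
    have := Nat.geomSum_eq hp.two_le h
    rw [this, Nat.mul_div_cancel']
    · have := Nat.one_le_pow h p hp.pos
      omega
    · simpa using Nat.sub_dvd_pow_sub_pow p 1 h
  set S := ∑ i ∈ Finset.range h, p ^ i with hS
  have hp1 : p - 1 = 2 * r := by omega
  rw [hp1] at hgeo
  have hPd : (∏ i ∈ Finset.range h, (f i) ^ r).natDegree = 2 * r * S := by
    rw [natDegree_prod _ _ (fun i _ => pow_ne_zero _ (hfne i))]
    simp_rw [natDegree_pow, hdeg]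
    rw [← Finset.mul_sum, Finset.sum_add_distrib, hgs]; ring
  have hP1 : ∏ i ∈ Finset.range h, (f i) ^ r = 1 := by
    apply s15_poly_ext
    · rw [hPd, hcard]; omega
    · rw [natDegree_one]; exact Fintype.card_pos
    · intro t
      rw [eval_prod, eval_one]
      have h1 : ∀ i ∈ Finset.range h, eval t (f i ^ r) = ((d + 4 * t * (ν + α * t ^ (p ^ k))) ^ r) ^ (p ^ i) := by
        intro i hi
        rw [eval_pow, hev t i hi, ← pow_mul, ← pow_mul, mul_comm (p ^ i) r]
      rw [Finset.prod_congr rfl h1, Finset.prod_pow_eq_pow_sum, ← pow_mul, ← hS]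
      have h3 := (FiniteField.isSquare_iff hrc (hcon t)).1 (hsq t)
      have h4 : Fintype.card F / 2 = r * S := by
        rw [hcard, ← hgeo, mul_assoc]; omega
      rwa [h4] at h3
  rw [hP1, natDegree_one] at hPd
  have : 1 < p ^ h := Nat.one_lt_pow (by omega) hp.one_lt
  omega

lemma s15_fixcard {F : Type*} [Field F] [Fintype F] (n : ℕ) (hn : 1 < n) :
    Nat.card {x : F // x ^ n = x} ≤ n := by
  classical
  have h1 : Nat.card {x : F // x ^ n = x} = (Finset.univ.filter (fun x : F => x ^ n = x)).card := by
    rw [Nat.card_eq_fintype_card, Fintype.card_subtype]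
  rw [h1]
  have h2 : (X ^ n - X : F[X]) ≠ 0 := FiniteField.X_pow_card_sub_X_ne_zero F hn
  have h3 : (Finset.univ.filter (fun x : F => x ^ n = x)) ⊆ (X ^ n - X : F[X]).roots.toFinset := by
    intro x hx
    simp only [Finset.mem_filter, Finset.mem_univ, true_and] at hx
    rw [Multiset.mem_toFinset, mem_roots h2, IsRoot.def]
    simp [hx]
  refine (Finset.card_le_card h3).trans ((Multiset.toFinset_card_le _).trans ((card_roots' _).trans ?_))
  rw [FiniteField.X_pow_card_sub_X_natDegree_eq F hn]

lemma s15_lemV {F : Type*} [Field F] [Fintype F] (p h k : ℕ) [Fact p.Prime] [CharP F p]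
    (hp2 : p ≠ 2) (hcard : Fintype.card F = p ^ h) (hq : 9 < p ^ h) (hk1 : 1 ≤ k) (hkh : k < h)
    (z w : F) (hz : z ≠ 0) (hw : w ≠ 0)
    (hsq : ∀ r, IsSquare (1 + (z * r + w * r ^ (p ^ k)))) :
    2 * k = h ∧ w = z ^ (p ^ k) := by
  classical
  have hp : p.Prime := Fact.out
  have hrc : ringChar F ≠ 2 := by rw [ringChar.eq F p]; exact hp2
  have h2ne : (2:F) ≠ 0 := Ring.two_ne_zero hrc
  have hpow1 : ∀ j, 1 ≤ j → 1 < p ^ j := fun j hj => Nat.one_lt_pow (by omega) hp.one_lt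
  have hNc : Nat.card F = p ^ h := by rw [Nat.card_eq_fintype_card, hcard]
  set P := p ^ k with hP
  have hadd : ∀ x y : F, (x + y) ^ P = x ^ P + y ^ P := fun x y => add_pow_char_pow x y p k
  set K := {x : F // x ^ P = x} with hK
  have hPq : P < p ^ h := Nat.pow_lt_pow_right hp.one_lt hkh
  have hK1 : Nat.card K ≤ P := s15_fixcard P (hpow1 k hk1)
  have hK2 : Nat.card K ≤ p ^ (h - k) := by
    refine le_trans ?_ (s15_fixcard (F := F) (p ^ (h - k)) (hpow1 _ (by omega)))
    refine Nat.card_le_card_of_injective (fun x : K => (⟨x.1, ?_⟩ : {x : F // x ^ (p ^ (h - k)) = x})) ?_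
    · have h1 : x.1 ^ (p ^ h) = x.1 := by rw [← hcard, FiniteField.pow_card]
      have h2 : p ^ h = P * p ^ (h - k) := by rw [hP, ← pow_add]; congr 1; omega
      rwa [h2, pow_mul, x.2] at h1
    · intro x y hxy
      exact Subtype.ext (by simpa using hxy)
  let l : F →+ F := 
    { toFun := fun r => z * r + w * r ^ P
      map_zero' := by simp [hP, hp.ne_zero]
      map_add' := by intro x y; rw [hadd]; ring }
  have hl : ∀ r, l r = z * r + w * r ^ P := fun r => rfl
  have hcardl : Nat.card l.ker * Nat.card l.range = p ^ h := by
    rw [← AddSubgroup.index_ker, AddSubgroup.card_mul_index, hNc]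
  have hsqV : ∀ v ∈ l.range, IsSquare (1 + v) := by
    rintro v ⟨r, rfl⟩
    exact hsq r
  have hKV : ∀ κ v : F, κ ^ P = κ → v ∈ l.range → κ * v ∈ l.range := by
    rintro κ v hκ ⟨r, rfl⟩
    refine ⟨κ * r, ?_⟩
    rw [hl, hl, mul_pow, hκ]; ring
  have hkerK : Nat.card l.ker ≤ Nat.card K := by
    by_cases hbot : ∃ r0 : F, r0 ≠ 0 ∧ l r0 = 0
    · obtain ⟨r0, hr0, hlr⟩ := hbot
      refine Nat.card_le_card_of_injective (fun r : l.ker => (⟨r.1 / r0, ?_⟩ : K)) ?_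
      · have h1 : l r.1 = 0 := r.2
        rw [hl] at h1 hlr
        rw [div_pow, div_eq_div_iff (pow_ne_zero _ hr0) hr0]
        apply mul_left_cancel₀ (mul_ne_zero hw hz)
        linear_combination (z * r0) * h1 - z * r.1 * hlr
      · intro x y hxy
        have h3 : x.1 / r0 = y.1 / r0 := congrArg Subtype.val hxy
        exact Subtype.ext ((div_left_inj' hr0).1 h3)
    · push Not at hbot
      have h1 : l.ker = ⊥ := by
        rw [eq_bot_iff]
        intro r hr
        by_contra hne
        exact hbot r (by simpa using hne) hr
      rw [h1, AddSubgroup.card_bot]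
      have : Nonempty K := ⟨⟨0, by simp [hP, hp.ne_zero]⟩⟩
      exact Nat.card_pos
  have hVpos : 0 < Nat.card l.range := Nat.card_pos
  have hKVq : p ^ h ≤ Nat.card K * Nat.card l.range := by
    rw [← hcardl]; exact Nat.mul_le_mul_right _ hkerK
  have hKinv : ∀ κ : F, κ ^ P = κ → (κ⁻¹) ^ P = κ⁻¹ := fun κ hκ => by rw [inv_pow, hκ]
  by_cases h1V : (1:F) ∈ l.range
  ·
    have hVsq : ∀ v ∈ l.range, IsSquare v := by
      intro v hv
      have := hsqV (v - 1) (sub_mem hv h1V)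
      rwa [add_sub_cancel] at this
    obtain ⟨x, hx⟩ := FiniteField.exists_nonsquare hrc
    have hx0 : x ≠ 0 := by rintro rfl; exact hx IsSquare.zero
    have hV2 : Nat.card l.range * Nat.card l.range ≤ p ^ h := by
      rw [← hNc, ← Nat.card_prod]
      refine Nat.card_le_card_of_injective (fun v : l.range × l.range => v.1.1 + x * v.2.1) ?_
      rintro ⟨⟨a, ha⟩, ⟨b, hb⟩⟩ ⟨⟨a', ha'⟩, ⟨b', hb'⟩⟩ heq
      simp only at heq
      have hbb : b = b' := by
        by_contra hne
        apply hx
        have h3 : b' - b ≠ 0 := sub_ne_zero.2 (Ne.symm hne)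
        have h4 : x = (a - a') / (b' - b) := by
          rw [eq_div_iff h3]; linear_combination -heq
        rw [h4]
        exact (hVsq _ (sub_mem ha ha')).div (hVsq _ (sub_mem hb' hb))
      subst hbb
      have : a = a' := by linear_combination heq
      subst this
      rfl
    have hKK : p ^ h ≤ Nat.card K * Nat.card K := by
      by_contra hlt
      push Not at hlt
      have h3 : Nat.card l.range ≤ Nat.card K ∨ Nat.card K < Nat.card l.range := le_or_gt _ _
      rcases h3 with h3 | h3
      · have := Nat.mul_le_mul_left (Nat.card K) h3; omega
      · have := Nat.mul_lt_mul_of_pos_right h3 hVpos; omega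
    have hsplit : p ^ h = P * p ^ (h - k) := by rw [hP, ← pow_add]; congr 1; omega
    have hPpos : 0 < P := by rw [hP]; exact pow_pos hp.pos _
    have hQpos : 0 < p ^ (h - k) := pow_pos hp.pos _
    have hKP : Nat.card K = P := by
      by_contra hne
      have h3 : Nat.card K < P := by omega
      have := Nat.mul_lt_mul_of_lt_of_le h3 hK2 hQpos
      omega
    have hKQ : Nat.card K = p ^ (h - k) := by
      by_contra hne
      have h3 : Nat.card K < p ^ (h - k) := by omega
      have := Nat.mul_lt_mul_of_le_of_lt hK1 h3 hPpos
      omega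
    have hk2 : k = h - k := by
      apply Nat.pow_right_injective hp.two_le
      show p ^ k = p ^ (h - k)
      rw [← hKQ, ← hP, hKP]
    refine ⟨by omega, ?_⟩
    have hVK : ∀ v ∈ l.range, v ^ P = v := by
      have hVle : Nat.card l.range ≤ Nat.card K := by
        by_contra hlt
        push Not at hlt
        have := Nat.mul_lt_mul'' hlt hlt
        omega
      let i : K → l.range := fun κ => ⟨κ.1, by simpa using hKV κ.1 1 κ.2 h1V⟩
      have hi : Function.Injective i := by
        intro a b hab
        exact Subtype.ext (by simpa [i] using hab)
      have hib : Function.Bijective i := by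
        have := Fintype.ofFinite K
        have := Fintype.ofFinite l.range
        rw [Fintype.bijective_iff_injective_and_card]
        refine ⟨hi, ?_⟩
        rw [← Nat.card_eq_fintype_card, ← Nat.card_eq_fintype_card]
        exact le_antisymm (Nat.card_le_card_of_injective i hi) hVle
      intro v hv
      obtain ⟨κ, hκ⟩ := hib.2 ⟨v, hv⟩
      have : κ.1 = v := by simpa [i] using congrArg Subtype.val hκ
      rw [← this]; exact κ.2
    have hPP : ∀ r : F, (r ^ P) ^ P = r := by
      intro r
      rw [← pow_mul, hP, ← pow_add]
      have : k + k = h := by omega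
      rw [this, ← hcard, FiniteField.pow_card]
    have hall : ∀ r : F, (z - w ^ P) * r + (w - z ^ P) * r ^ P = 0 := by
      intro r
      have h3 := hVK (l r) ⟨r, rfl⟩
      rw [hl, hadd, mul_pow, mul_pow, hPP] at h3
      linear_combination -h3
    by_contra hne
    have hs : w - z ^ P ≠ 0 := sub_ne_zero.2 hne
    have h1 := hall 1
    rw [one_pow, mul_one, mul_one] at h1
    have hfix : ∀ r : F, r ^ P = r := by
      intro r
      apply mul_left_cancel₀ hs
      linear_combination hall r - r * h1
    have : Nat.card F ≤ Nat.card K := Nat.card_le_card_of_injective (fun r => (⟨r, hfix r⟩ : K)) (by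
      intro a b hab; exact congrArg Subtype.val hab)
    omega
  · exfalso
    have hsub : ∀ a b : F, a ^ P = a → b ^ P = b → (a - b) ^ P = a - b := by
      intro a b ha hb
      rw [hP, sub_pow_char_pow, ← hP, ha, hb]
    have hKV0 : ∀ κ : F, κ ^ P = κ → κ ∈ l.range → κ = 0 := by
      intro κ hκ hκV
      by_contra hne
      apply h1V
      have := hKV κ⁻¹ κ (hKinv κ hκ) hκV
      rwa [inv_mul_cancel₀ hne] at this
    let i : K × l.range → F := fun y => y.1.1 + y.2.1
    have hi : Function.Injective i := by
      rintro ⟨⟨a, ha⟩, ⟨b, hb⟩⟩ ⟨⟨a', ha'⟩, ⟨b', hb'⟩⟩ heq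
      simp only [i] at heq
      have h3 : a - a' = 0 := by
        apply hKV0 _ (hsub a a' ha ha')
        have : a - a' = b' - b := by linear_combination heq
        rw [this]; exact sub_mem hb' hb
      have h4 : a = a' := sub_eq_zero.1 h3
      subst h4
      have : b = b' := by linear_combination heq
      subst this
      rfl
    have hle := Nat.card_le_card_of_injective i hi
    rw [Nat.card_prod, hNc] at hle
    have hKVeq : Nat.card K * Nat.card l.range = p ^ h := le_antisymm hle hKVq
    have hib : Function.Bijective i := by
      have := Fintype.ofFinite (K × l.range)
      rw [Fintype.bijective_iff_injective_and_card]
      refine ⟨hi, ?_⟩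
      rw [← Nat.card_eq_fintype_card, Nat.card_prod, hKVeq, hcard]
    have hsurj : ∀ x : F, ∃ κ v : F, κ ^ P = κ ∧ v ∈ l.range ∧ x = κ + v := by
      intro x
      obtain ⟨⟨κ, v⟩, hκv⟩ := hib.2 x
      exact ⟨κ.1, v.1, κ.2, v.2, hκv.symm⟩
    have hnm1 : (-1:F) ∉ l.range := fun hh => h1V (by simpa using neg_mem hh)
    have hPodd : Odd P := (hp.odd_of_ne_two hp2).pow
    have hK3 : 3 ≤ Nat.card K := by
      have h0 : (0:F) ^ P = 0 := zero_pow (by rw [hP]; exact (pow_pos hp.pos _).ne')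
      have h1 : (1:F) ^ P = 1 := one_pow _
      have hm1 : (-1:F) ^ P = -1 := hPodd.neg_one_pow
      let f : Fin 3 → K := ![⟨0, h0⟩, ⟨1, h1⟩, ⟨-1, hm1⟩]
      have hf : Function.Injective f := by
        have hne : (1:F) ≠ -1 := by
          intro hh; apply h2ne; linear_combination hh
        intro a b hab
        have hab' := congrArg Subtype.val hab
        fin_cases a <;> fin_cases b <;> simp [f, hne, hne.symm] at hab' ⊢
      simpa using Nat.card_le_card_of_injective f hf
    have hVV : ∃ v ∈ l.range, ∃ v' ∈ l.range, v * v' ∉ l.range := by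
      by_contra hcl
      push Not at hcl
      have hpw : ∀ v ∈ l.range, ∀ n, v ^ (n + 1) ∈ l.range := by
        intro v hv n
        induction n with
        | zero => simpa using hv
        | succ n ih => rw [pow_succ]; exact hcl _ ih _ hv
      have : ∃ v ∈ l.range, v ≠ 0 := by
        by_contra hz0
        push Not at hz0
        have : Nat.card l.range ≤ 1 := by
          rw [Finite.card_le_one_iff_subsingleton]
          exact ⟨fun a b => Subtype.ext (by rw [hz0 a.1 a.2, hz0 b.1 b.2])⟩
        have : Nat.card l.range = 1 := by omega
        rw [this] at hKVeq
        omega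
      obtain ⟨v, hv, hv0⟩ := this
      apply h1V
      have h3 := hpw v hv (Fintype.card F - 2)
      have h4 : Fintype.card F - 2 + 1 = Fintype.card F - 1 := by omega
      rwa [h4, FiniteField.pow_card_sub_one_eq_one v hv0] at h3
    obtain ⟨v, hv, v', hv', hvv⟩ := hVV
    obtain ⟨κ0, v0, hκ0, hv0, hvv0⟩ := hsurj (v * v')
    have hkappa_ne : κ0 ≠ 0 := by
      rintro rfl
      rw [zero_add] at hvv0
      exact hvv (hvv0 ▸ hv0)
    have hmulK : ∀ a b : F, a ^ P = a → b ^ P = b → (a * b) ^ P = a * b := by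
      intro a b ha hb; rw [mul_pow, ha, hb]
    have hKsq : ∀ κ : F, κ ^ P = κ → IsSquare κ := by
      intro κ hκ
      by_cases hκz : κ = 0
      · rw [hκz]; exact IsSquare.zero
      have hlam : ((κ - 1) * κ0⁻¹) ^ P = (κ - 1) * κ0⁻¹ :=
        hmulK _ _ (hsub _ _ hκ (one_pow _)) (hKinv _ hκ0)
      set lam := (κ - 1) * κ0⁻¹ with hlam'
      have hlk : lam * κ0 = κ - 1 := by rw [hlam', mul_assoc, inv_mul_cancel₀ hkappa_ne, mul_one]
      have h3 : IsSquare ((1 + lam * v) * (1 + v')) :=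
        (hsqV _ (hKV _ _ hlam hv)).mul (hsqV _ hv')
      have hu : lam * v + v' + lam * v0 ∈ l.range :=
        add_mem (add_mem (hKV _ _ hlam hv) hv') (hKV _ _ hlam hv0)
      set u := lam * v + v' + lam * v0 with hu'
      have h4 : (1 + lam * v) * (1 + v') = κ * (1 + κ⁻¹ * u) := by
        have : κ * (1 + κ⁻¹ * u) = κ + u := by field_simp
        rw [this, hu']
        linear_combination lam * hvv0 + hlk
      rw [h4] at h3
      have hin := hKV _ _ (hKinv _ hκ) hu
      have h5 := hsqV _ hin
      have h6 : 1 + κ⁻¹ * u ≠ 0 := by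
        intro h0
        apply hnm1
        have : κ⁻¹ * u = -1 := by linear_combination h0
        rwa [this] at hin
      have h7 := h3.div h5
      rwa [mul_div_cancel_right₀ _ h6] at h7
    have hFV : ∀ x : F, x ∉ l.range → IsSquare x := by
      intro x hx
      obtain ⟨κ, v, hκ, hv, rfl⟩ := hsurj x
      have hκz : κ ≠ 0 := by
        rintro rfl
        rw [zero_add] at hx; exact hx hv
      have : κ + v = κ * (1 + κ⁻¹ * v) := by field_simp
      rw [this]
      exact (hKsq κ hκ).mul (hsqV _ (hKV _ _ (hKinv _ hκ) hv))
    have hcnt := s15_sqcount hrc (Finset.univ.filter (fun x : F => x ∉ l.range)) (by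
      intro x hx; exact hFV x (Finset.mem_filter.1 hx).2)
    have hsplit := Finset.card_filter_add_card_filter_not (s := (Finset.univ : Finset F)) (fun x : F => x ∈ l.range)
    have hVc : (Finset.univ.filter (fun x : F => x ∈ l.range)).card = Nat.card l.range := by
      rw [Nat.card_eq_fintype_card]
      exact (Fintype.card_subtype _).symm
    rw [hVc, Finset.card_univ, hcard] at hsplit
    rw [hcard] at hcnt
    have := Nat.mul_le_mul_right (Nat.card l.range) hK3
    omega

lemma s15_shift {F : Type*} [Field F] [Fintype F] [DecidableEq F] (C1 C2 : Finset F) (ε1 ε2 : ℕ)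
    (h1 : C1.card + ε1 = Fintype.card F) (h2 : C2.card + ε2 = Fintype.card F) (t : F) :
    Fintype.card F ≤ (C2.filter (fun c => c + t ∈ C1)).card + ε1 + ε2 := by
  have h3 := Finset.card_filter_add_card_filter_not (s := C2) (fun c => c + t ∈ C1)
  have h4 : (C2.filter (fun c => ¬ c + t ∈ C1)).card ≤ (C1ᶜ).card := by
    apply Finset.card_le_card_of_injOn (fun c => c + t)
    · intro c hc
      simp at hc ⊢
      exact hc.2
    · intro a _ b _ hab
      exact add_right_cancel hab
  rw [Finset.card_compl] at h4
  omega

lemma s15_pair {F : Type*} [Field F] [Fintype F] (p h k : ℕ) [Fact p.Prime] [CharP F p]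
    (hp2 : p ≠ 2) (hcard : Fintype.card F = p ^ h) (hq : 9 < p ^ h) (hk1 : 1 ≤ k) (hkh : k < h)
    (C1 C2 : Finset F) (ε1 ε2 : ℕ) (hC1 : C1.card + ε1 = p ^ h) (hC2 : C2.card + ε2 = p ^ h)
    (hε1 : (2 * ε1 + 1) ^ 2 < p ^ h) (hε2 : (2 * ε2 + 1) ^ 2 < p ^ h)
    (α α' γ γ' δ : F) (hα : α ≠ 0) (hαs : IsSquare α) (hδ : δ ≠ 0)
    (hsq : ∀ c ∈ C1, ∀ c' ∈ C2,
      IsSquare (δ ^ 2 + 4 * ((γ + α * c ^ (p ^ k)) - (γ' + α' * c' ^ (p ^ k))) * (c - c'))) :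
    2 * k = h ∧ α = α' ∧ ∃ z, δ ^ 2 = - 4 * α * (z * z ^ (p ^ k)) := by
  classical
  have hp : p.Prime := Fact.out
  have hrc : ringChar F ≠ 2 := by rw [ringChar.eq F p]; exact hp2
  have h2ne : (2:F) ≠ 0 := Ring.two_ne_zero hrc
  have h4ne : (4:F) ≠ 0 := by
    have : (4:F) = 2 * 2 := by norm_num
    rw [this]; exact mul_ne_zero h2ne h2ne
  have hshift := s15_shift C1 C2 ε1 ε2 (by omega) (by omega)
  have hb1 : 4 * ε1 + 1 < p ^ h := by nlinarith
  have hb2 : 4 * ε2 + 1 < p ^ h := by nlinarith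
  have hαα : α = α' := by
    by_contra hne
    have hc := s15_sqcount hrc ((C2.filter (fun c => c + 1 ∈ C1)).image
      (fun c' => δ ^ 2 + 4 * ((γ + α * (c' + 1) ^ (p ^ k)) - (γ' + α' * c' ^ (p ^ k))) * ((c' + 1) - c'))) (by
        intro x hx
        obtain ⟨c', hc', rfl⟩ := Finset.mem_image.1 hx
        have := Finset.mem_filter.1 hc'
        exact hsq _ this.2 _ this.1)
    rw [Finset.card_image_of_injective] at hc
    · have := hshift 1
      omega
    · intro x y hxy
      simp only [add_pow_char_pow, one_pow] at hxy
      have h3 : (α - α') * (x ^ p ^ k - y ^ p ^ k) = 0 := by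
        apply mul_left_cancel₀ h4ne
        linear_combination hxy
      have h4 := (mul_eq_zero.1 h3).resolve_left (sub_ne_zero.2 hne)
      rw [← sub_pow_char_pow] at h4
      exact sub_eq_zero.1 (pow_eq_zero_iff (pow_pos hp.pos k).ne' |>.1 h4)
  subst hαα
  have hD : ∀ t, IsSquare (δ ^ 2 + 4 * t * ((γ - γ') + α * t ^ (p ^ k))) := by
    intro t
    have h3 : 0 < (C2.filter (fun c => c + t ∈ C1)).card := by
      have := hshift t
      omega
    obtain ⟨c, hc⟩ := Finset.card_pos.1 h3
    have h4 := Finset.mem_filter.1 hc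
    have h5 := hsq _ h4.2 _ h4.1
    rw [add_pow_char_pow] at h5
    convert h5 using 1
    ring
  obtain ⟨z, hz⟩ := s15_haszero p h k hp2 hcard hk1 hkh α (γ - γ') (δ ^ 2) hα hD
  have hPpos : p ^ k ≠ 0 := (pow_pos hp.pos k).ne'
  have hz0 : z ≠ 0 := by
    rintro rfl
    simp [hδ] at hz
  set w := z ^ (p ^ k) + (γ - γ') / α with hw
  have hwα : α * w = (γ - γ') + α * z ^ (p ^ k) := by
    rw [hw]; field_simp; ring
  rw [← hwα] at hz
  have hw0 : w ≠ 0 := by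
    intro h0
    rw [h0] at hz
    simp [hδ] at hz
  obtain ⟨s, hs⟩ : Odd (p ^ k) := (hp.odd_of_ne_two hp2).pow
  have hsq2 : ∀ r, IsSquare (1 + (z * r + w * r ^ (p ^ k))) := by
    intro r
    by_cases hr : r = 0
    · rw [hr, zero_pow hPpos]; simp
    have h3 := hD (z + r⁻¹)
    obtain ⟨β, hβ⟩ := hαs
    have hβ0 : β ≠ 0 := by rintro rfl; simp at hβ; exact hα hβ
    have h5 : δ ^ 2 + 4 * (z + r⁻¹) * ((γ - γ') + α * (z + r⁻¹) ^ (p ^ k))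
        = (1 + (z * r + w * r ^ (p ^ k))) * (2 * β * (r⁻¹) ^ (s + 1)) ^ 2 := by
      rw [add_pow_char_pow]
      have h6 : ((r⁻¹) ^ (s + 1)) ^ 2 = (r⁻¹) ^ (p ^ k) * r⁻¹ := by rw [hs]; ring
      have h7 : r ^ (p ^ k) * (r⁻¹) ^ (p ^ k) = 1 := by rw [← mul_pow, mul_inv_cancel₀ hr, one_pow]
      have h8 : r * r⁻¹ = 1 := mul_inv_cancel₀ hr
      have h9 : (2 * β * (r⁻¹) ^ (s + 1)) ^ 2 = 4 * α * ((r⁻¹) ^ (p ^ k) * r⁻¹) := by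
        rw [← h6, hβ]; ring
      rw [h9]
      linear_combination hz - 4 * (z + r⁻¹) * hwα - 4 * α * z * (r⁻¹) ^ (p ^ k) * h8 - 4 * α * w * r⁻¹ * h7
    rw [h5] at h3
    have h10 : (2 * β * (r⁻¹) ^ (s + 1)) ^ 2 ≠ 0 :=
      pow_ne_zero _ (mul_ne_zero (mul_ne_zero h2ne hβ0) (pow_ne_zero _ (inv_ne_zero hr)))
    have h11 := h3.div (IsSquare.sq (2 * β * (r⁻¹) ^ (s + 1)))
    rwa [mul_div_cancel_right₀ _ h10] at h11
  obtain ⟨hk2, hwz⟩ := s15_lemV p h k hp2 hcard hq hk1 hkh z w hz0 hw0 hsq2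
  refine ⟨hk2, rfl, z, ?_⟩
  rw [hwz] at hz
  linear_combination hz

lemma s15_two {F : Type*} [Field F] (b x : F) (A : Finset F) (hA : ∀ u ∈ A, (u - b) ^ 2 = x) :
    A.card ≤ 2 := by
  classical
  rcases A.eq_empty_or_nonempty with rfl | ⟨u0, hu0⟩
  · simp
  have : A ⊆ {u0, 2 * b - u0} := by
    intro u hu
    have h1 : (u - u0) * (u - (2 * b - u0)) = 0 := by linear_combination hA u hu - hA u0 hu0
    rw [Finset.mem_insert, Finset.mem_singleton]
    rcases mul_eq_zero.1 h1 with h | h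
    · left; exact sub_eq_zero.1 h
    · right; exact sub_eq_zero.1 h
  exact (Finset.card_le_card this).trans Finset.card_le_two

lemma s15_SQ {F : Type*} [Field F] [Fintype F] (h2 : ringChar F ≠ 2) (κ : F) (hκ : κ ≠ 0)
    (T : Finset F) (hT : ∀ u ∈ T, IsSquare (u ^ 2 + κ)) : 2 * T.card ≤ Fintype.card F + 4 := by
  classical
  have h2ne : (2:F) ≠ 0 := Ring.two_ne_zero h2
  have hT' : ∀ u ∈ T, ∃ s, u ^ 2 + κ = s * s := hT
  choose! s hs using hT'
  have hz : (T.filter (fun u => s u = 0)).card ≤ 2 := by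
    apply s15_two 0 (-κ)
    intro u hu
    have h1 := Finset.mem_filter.1 hu
    have h3 := hs u h1.1
    rw [h1.2] at h3
    linear_combination h3
  have hsplit := Finset.card_filter_add_card_filter_not (s := T) (fun u => s u = 0)
  have hne : (1:F) ≠ -1 := by
    intro hh; apply h2ne; linear_combination hh
  have hle : ((T.filter (fun u => ¬ s u = 0)) ×ˢ ({1, -1} : Finset F)).card ≤ (Finset.univ : Finset F).card := by
    apply Finset.card_le_card_of_injOn (fun y => y.2 * s y.1 - y.1) (fun _ _ => Finset.mem_univ _)
    rintro ⟨u, σ⟩ hu ⟨u', σ'⟩ hu' heq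
    simp only [Finset.coe_product, Set.mem_prod, Finset.mem_coe, Finset.mem_filter, Finset.mem_insert, Finset.mem_singleton] at hu hu'
    simp only at heq
    have h3 := hs u hu.1.1
    have h4 := hs u' hu'.1.1
    have hσ : σ ^ 2 = 1 := by rcases hu.2 with h | h <;> rw [h] <;> ring
    have hσ' : σ' ^ 2 = 1 := by rcases hu'.2 with h | h <;> rw [h] <;> ring
    have h5 : (σ * s u - u) * (σ * s u + u) = κ := by linear_combination s u ^ 2 * hσ - h3
    have h6 : (σ' * s u' - u') * (σ' * s u' + u') = κ := by linear_combination s u' ^ 2 * hσ' - h4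
    have hm : σ * s u - u ≠ 0 := by
      intro h0; rw [h0, zero_mul] at h5; exact hκ h5.symm
    have h7 : σ * s u + u = σ' * s u' + u' := by
      apply mul_left_cancel₀ hm
      rw [h5]
      rw [heq, h6]
    have h8 : u = u' := by
      apply mul_left_cancel₀ h2ne
      linear_combination h7 - heq
    subst h8
    have h9 : σ = σ' := by
      apply mul_right_cancel₀ hu.1.2
      linear_combination h7
    rw [h9]
  rw [Finset.card_product, Finset.card_pair hne, Finset.card_univ] at hle
  omega

lemma s15_lin {F : Type*} [Field F] [Fintype F] (h2 : ringChar F ≠ 2) (Cs : Finset F) (ε : ℕ)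
    (hC : Cs.card + ε = Fintype.card F) (hε : (2 * ε + 1) ^ 2 < Fintype.card F) (hq : 9 < Fintype.card F)
    (ρ γ φ' c' δ : F)
    (hsq : ∀ c ∈ Cs, IsSquare (δ ^ 2 + 4 * (γ + ρ ^ 2 * c - φ') * (c - c'))) :
    (γ + ρ ^ 2 * c' - φ') ^ 2 = ρ ^ 2 * δ ^ 2 := by
  classical
  have h2ne : (2:F) ≠ 0 := Ring.two_ne_zero h2
  have h4ne : (4:F) ≠ 0 := by
    have : (4:F) = 2 * 2 := by norm_num
    rw [this]; exact mul_ne_zero h2ne h2ne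
  have hb : 2 * ε + 4 < Fintype.card F := by
    rcases Nat.lt_or_ge ε 3 with h | h
    · omega
    · nlinarith
  by_contra hne
  by_cases hρ : ρ = 0
  · subst hρ
    have hν : γ - φ' ≠ 0 := by
      intro h0; apply hne; linear_combination (γ - φ') * h0
    have hc := s15_sqcount h2 (Cs.image (fun c => δ ^ 2 + 4 * (γ + 0 ^ 2 * c - φ') * (c - c'))) (by
      intro x hx
      obtain ⟨c, hc, rfl⟩ := Finset.mem_image.1 hx
      exact hsq c hc)
    rw [Finset.card_image_of_injective] at hc
    · omega
    · intro x y hxy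
      simp only at hxy
      apply mul_left_cancel₀ (mul_ne_zero h4ne hν)
      linear_combination hxy
  · have hκ : δ ^ 2 - (γ + ρ ^ 2 * c' - φ') ^ 2 / ρ ^ 2 ≠ 0 := by
      intro h0
      apply hne
      field_simp at h0
      linear_combination -h0
    have hc := s15_SQ h2 _ hκ (Cs.image (fun c => 2 * ρ * (c - c') + (γ + ρ ^ 2 * c' - φ') / ρ)) (by
      intro x hx
      obtain ⟨c, hc, rfl⟩ := Finset.mem_image.1 hx
      convert hsq c hc using 1
      field_simp
      ring)
    rw [Finset.card_image_of_injective] at hc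
    · omega
    · intro x y hxy
      simp only at hxy
      apply mul_left_cancel₀ (mul_ne_zero h2ne hρ)
      linear_combination hxy

lemma s15_additive_two {F : Type*} [Field F] [Fintype F] (hodd : Odd (Fintype.card F)) (Cs : Finset F) (ε : ℕ)
    (hC : Cs.card + ε = Fintype.card F) (hε : (2 * ε + 1) ^ 2 < Fintype.card F) 
    (l : F →+ F) (v1 v2 : F) (hv : ∀ c ∈ Cs, l c = v1 ∨ l c = v2) : ∀ x, l x = 0 := by
  classical
  have hfib : ∀ v, (Cs.filter (fun c => l c = v)).card ≤ Nat.card l.ker := by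
    intro v
    rcases (Cs.filter (fun c => l c = v)).eq_empty_or_nonempty with h | ⟨c0, hc0⟩
    · rw [h]; simp
    have h0 := (Finset.mem_filter.1 hc0).2
    rw [← Fintype.card_coe, ← Nat.card_eq_fintype_card]
    refine Nat.card_le_card_of_injective (fun c => (⟨c.1 - c0, ?_⟩ : l.ker)) ?_
    · have h1 := (Finset.mem_filter.1 c.2).2
      rw [AddMonoidHom.mem_ker, map_sub, h1, h0, sub_self]
    · intro a b hab
      have h3 : a.1 - c0 = b.1 - c0 := congrArg Subtype.val hab
      exact Subtype.ext (sub_left_injective h3)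
  have hle : Cs.card ≤ Nat.card l.ker + Nat.card l.ker := by
    have : Cs ⊆ (Cs.filter (fun c => l c = v1)) ∪ (Cs.filter (fun c => l c = v2)) := by
      intro c hc
      rcases hv c hc with h | h
      · exact Finset.mem_union_left _ (Finset.mem_filter.2 ⟨hc, h⟩)
      · exact Finset.mem_union_right _ (Finset.mem_filter.2 ⟨hc, h⟩)
    exact (Finset.card_le_card this).trans ((Finset.card_union_le _ _).trans (add_le_add (hfib v1) (hfib v2)))
  have hidx := AddSubgroup.card_mul_index l.ker
  rw [Nat.card_eq_fintype_card (α := F)] at hidx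
  have hodd2 : Odd l.ker.index := by
    rw [← hidx] at hodd
    exact (Nat.odd_mul.1 hodd).2
  have h1 : l.ker.index = 1 := by
    by_contra hne
    have h3 : 3 ≤ l.ker.index := by
      obtain ⟨m, hm⟩ := hodd2; omega
    have := Nat.mul_le_mul_left (Nat.card l.ker) h3
    nlinarith
  have htop := AddSubgroup.index_eq_one.1 h1
  intro x
  have : x ∈ l.ker := by rw [htop]; trivial
  exact this

lemma s15_exists_linear {F : Type*} [Field F] [Fintype F] (p h : ℕ) [Fact p.Prime] [CharP F p]
    (hp2 : p ≠ 2) (hcard : Fintype.card F = p ^ h) (hq : 9 < p ^ h)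
    (dM : Finset F) (Cs : F → Finset F) (ε : F → ℕ) (α γ : F → F) (k : F → ℕ)
    (hC : ∀ b ∈ dM, (Cs b).card + ε b = p ^ h)
    (hε : ∀ b ∈ dM, (2 * ε b + 1) ^ 2 < p ^ h)
    (hα : ∀ b ∈ dM, IsSquare (α b)) (hk : ∀ b ∈ dM, p ^ (k b) < p ^ h)
    (hsq : ∀ b ∈ dM, ∀ b' ∈ dM, ∀ c ∈ Cs b, ∀ c' ∈ Cs b',
      IsSquare ((b - b') ^ 2 + 4 * ((γ b + α b * c ^ (p ^ (k b))) -
        (γ b' + α b' * c' ^ (p ^ (k b')))) * (c - c')))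
    (hbig : p ^ h < 2 * dM.card) : ∃ b ∈ dM, α b = 0 ∨ k b = 0 := by
  classical
  have hp : p.Prime := Fact.out
  have hp3 : 3 ≤ p := by have := hp.two_le; omega
  by_contra hcon
  push Not at hcon
  have hkh : ∀ b ∈ dM, k b < h := fun b hb => (Nat.pow_lt_pow_iff_right hp.one_lt).1 (hk b hb)
  have hk1 : ∀ b ∈ dM, 1 ≤ k b := fun b hb => Nat.one_le_iff_ne_zero.2 (hcon b hb).2
  have hpair : ∀ b ∈ dM, ∀ b' ∈ dM, b ≠ b' → k b = k b' →
      2 * k b = h ∧ ∃ z, (b - b') ^ 2 = - 4 * α b * (z * z ^ (p ^ (k b))) := by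
    intro b hb b' hb' hne hkk
    have := s15_pair p h (k b) hp2 hcard hq (hk1 b hb) (hkh b hb) (Cs b) (Cs b') (ε b) (ε b')
      (hC b hb) (hC b' hb') (hε b hb) (hε b' hb') (α b) (α b') (γ b) (γ b') (b - b')
      (hcon b hb).1 (hα b hb) (sub_ne_zero.2 hne) (by
        intro c hc c' hc'
        have := hsq b hb b' hb' c hc c' hc'
        rw [← hkk] at this
        exact this)
    exact ⟨this.1, this.2.2⟩
  by_cases hex : ∃ k0, 2 * k0 = h
  · obtain ⟨k0, hk0⟩ := hex
    have hrest : (dM.filter (fun b => ¬ k b = k0)).card ≤ ((Finset.Ico 1 h).erase k0).card := by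
      apply Finset.card_le_card_of_injOn k
      · intro b hb
        have hb' := Finset.mem_filter.1 hb
        rw [Finset.mem_coe, Finset.mem_erase, Finset.mem_Ico]
        exact ⟨hb'.2, hk1 b hb'.1, hkh b hb'.1⟩
      · intro b hb b' hb' hkk
        have h1 := Finset.mem_filter.1 hb
        have h2 := Finset.mem_filter.1 hb'
        by_contra hne
        have := (hpair b h1.1 b' h2.1 hne hkk).1
        exact h1.2 (by omega)
    have hk0pos : 1 ≤ k0 := by
      rcases Nat.eq_zero_or_pos k0 with h0 | h0
      · subst h0; simp at hk0; subst hk0; simp at hq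
      · exact h0
    rw [Finset.card_erase_of_mem (Finset.mem_Ico.2 ⟨hk0pos, by omega⟩), Nat.card_Ico] at hrest
    have hs1 : 1 < p ^ k0 := Nat.one_lt_pow (by omega) hp.one_lt
    have hss : p ^ k0 * p ^ k0 = p ^ h := by rw [← pow_add, ← hk0, two_mul]
    have hfib : (dM.filter (fun b => k b = k0)).card ≤ 2 * p ^ k0 := by
      rcases (dM.filter (fun b => k b = k0)).eq_empty_or_nonempty with he | ⟨b0, hb0⟩
      · rw [he]; simp
      have h0 := Finset.mem_filter.1 hb0
      let K : Finset F := Finset.univ.filter (fun x : F => x ^ (p ^ k0) = x)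
      have hK : K.card ≤ p ^ k0 := by
        have := s15_fixcard (F := F) (p ^ k0) hs1
        rwa [Nat.card_eq_fintype_card, Fintype.card_subtype] at this
      have hsub : dM.filter (fun b => k b = k0) ⊆
          K.biUnion (fun κ => Finset.univ.filter (fun u : F => (u - b0) ^ 2 = -4 * α b0 * κ)) := by
        intro b hb
        have h1 := Finset.mem_filter.1 hb
        rw [Finset.mem_biUnion]
        by_cases hne : b0 = b
        · refine ⟨0, ?_, ?_⟩
          · simp only [K, Finset.mem_filter, Finset.mem_univ, true_and]
            exact zero_pow (by omega)
          · simp [hne]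
        · obtain ⟨_, z, hz⟩ := hpair b0 h0.1 b h1.1 hne (h0.2.trans h1.2.symm)
          rw [h0.2] at hz
          refine ⟨z * z ^ (p ^ k0), ?_, ?_⟩
          · simp only [K, Finset.mem_filter, Finset.mem_univ, true_and]
            rw [mul_pow, ← pow_mul, hss, ← hcard, FiniteField.pow_card, mul_comm]
          · simp only [Finset.mem_filter, Finset.mem_univ, true_and]
            rw [← hz]; ring
      calc _ ≤ _ := Finset.card_le_card hsub
        _ ≤ K.card * 2 := Finset.card_biUnion_le_card_mul _ _ _ (fun κ _ =>
            s15_two b0 (-4 * α b0 * κ) _ (fun u hu => (Finset.mem_filter.1 hu).2))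
        _ ≤ _ := by omega
    have hsplit := Finset.card_filter_add_card_filter_not (s := dM) (fun b => k b = k0)
    have hsodd : Odd (p ^ k0) := (hp.odd_of_ne_two hp2).pow
    have hsbig : 2 * k0 + 1 ≤ p ^ k0 := by
      have h1 : 3 ^ k0 ≤ p ^ k0 := Nat.pow_le_pow_left hp3 k0
      have h2 : ∀ n : ℕ, 2 * n + 1 ≤ 3 ^ n := by
        intro n
        induction n with
        | zero => simp
        | succ n ih => rw [pow_succ]; omega
      exact (h2 k0).trans h1
    generalize p ^ k0 = s at *
    have h5 : 5 ≤ s := by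
      obtain ⟨m, hm⟩ := hsodd
      have : 3 < s := by nlinarith
      omega
    have : s * s < 6 * s - 6 := by omega
    have h6 : s * s + 6 < 6 * s := by omega
    nlinarith
  · have hle : dM.card ≤ (Finset.Ico 1 h).card := by
      apply Finset.card_le_card_of_injOn k
      · intro b hb
        rw [Finset.mem_coe, Finset.mem_Ico]
        exact ⟨hk1 b hb, hkh b hb⟩
      · intro b hb b' hb' hkk
        by_contra hne
        exact hex ⟨k b, (hpair b hb b' hb' hne hkk).1⟩
    rw [Nat.card_Ico] at hle
    have h1 : 3 ^ h ≤ p ^ h := Nat.pow_le_pow_left hp3 h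
    have h2 : ∀ n : ℕ, 2 * n + 1 ≤ 3 ^ n := by
      intro n
      induction n with
      | zero => simp
      | succ n ih => rw [pow_succ]; omega
    have := h2 h
    omega

lemma s15_final {F : Type*} [Field F] [Fintype F] (p h : ℕ) [Fact p.Prime] [CharP F p]
    (hp2 : p ≠ 2) (hcard : Fintype.card F = p ^ h) (hq : 9 < p ^ h)
    (dM : Finset F) (Cs : F → Finset F) (ε : F → ℕ) (φ : F → F → F)
    (hC : ∀ b ∈ dM, (Cs b).card + ε b = p ^ h)
    (hε : ∀ b ∈ dM, (2 * ε b + 1) ^ 2 < p ^ h)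
    (hsq : ∀ b ∈ dM, ∀ b' ∈ dM, ∀ c ∈ Cs b, ∀ c' ∈ Cs b',
      IsSquare ((b - b') ^ 2 + 4 * (φ b c - φ b' c') * (c - c')))
    (hbig : p ^ h < 2 * dM.card) :
    ∃ A B : F, ∀ b ∈ dM, ∀ c ∈ Cs b, - φ b c + b * A + c * A ^ 2 = B := by
  classical
  have hp : p.Prime := Fact.out
  have hrc : ringChar F ≠ 2 := by rw [ringChar.eq F p]; exact hp2
  have h2ne : (2:F) ≠ 0 := Ring.two_ne_zero hrc
  have hodd : Odd (Fintype.card F) := by rw [hcard]; exact (hp.odd_of_ne_two hp2).pow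
  have hsl : ∀ b : F, ∃ (α γ : F) (k : ℕ), b ∈ dM → p ^ k < p ^ h ∧ IsSquare α ∧
      ∀ x ∈ Cs b, φ b x = γ + α * x ^ (p ^ k) := by
    intro b
    by_cases hb : b ∈ dM
    · obtain ⟨α, γ, k, h1⟩ := s15_slice p h hp2 hcard hq (ε b) (hε b hb) (Cs b) (hC b hb) (φ b) (by
        intro x hx y hy
        obtain ⟨r, hr⟩ := hsq b hb b hb x hx y hy
        refine ⟨r / 2, ?_⟩
        field_simp
        linear_combination hr)
      exact ⟨α, γ, k, fun _ => h1⟩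
    · exact ⟨0, 0, 0, fun hh => absurd hh hb⟩
  choose α γ k hsl using hsl
  have hφ : ∀ b ∈ dM, ∀ c ∈ Cs b, φ b c = γ b + α b * c ^ (p ^ (k b)) :=
    fun b hb => (hsl b hb).2.2
  obtain ⟨b0, hb0, hlin⟩ := s15_exists_linear p h hp2 hcard hq dM Cs ε α γ k hC hε
    (fun b hb => (hsl b hb).2.1) (fun b hb => (hsl b hb).1) (by
      intro b hb b' hb' c hc c' hc'
      rw [← hφ b hb c hc, ← hφ b' hb' c' hc']
      exact hsq b hb b' hb' c hc c' hc') hbig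
  have hne : ∀ b ∈ dM, (Cs b).Nonempty := by
    intro b hb
    rw [← Finset.card_pos]
    have h1 := hC b hb
    have h2 := hε b hb
    by_contra h3
    have h4 : ε b = p ^ h := by omega
    rw [h4] at h2
    nlinarith
  obtain ⟨γ0, ρ, h0⟩ : ∃ γ0 ρ, ∀ c ∈ Cs b0, φ b0 c = γ0 + ρ ^ 2 * c := by
    rcases hlin with h1 | h1
    · refine ⟨γ b0, 0, fun c hc => ?_⟩
      rw [hφ b0 hb0 c hc, h1]; ring
    · obtain ⟨ρ, hρ⟩ := (hsl b0 hb0).2.1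
      refine ⟨γ b0, ρ, fun c hc => ?_⟩
      rw [hφ b0 hb0 c hc, h1, hρ]; ring
  have key : ∀ b1 ∈ dM, ∀ g, (∀ c ∈ Cs b1, φ b1 c = g + ρ ^ 2 * c) → ∀ b ∈ dM, ∀ c ∈ Cs b,
      (g + ρ ^ 2 * c - φ b c) ^ 2 = ρ ^ 2 * (b1 - b) ^ 2 := by
    intro b1 hb1 g hg b hb c hc
    apply s15_lin hrc (Cs b1) (ε b1) (by rw [hcard]; exact hC b1 hb1) (by rw [hcard]; exact hε b1 hb1)
      (by rw [hcard]; exact hq)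
    intro c1 hc1
    rw [← hg c1 hc1]
    exact hsq b1 hb1 b hb c1 hc1 c hc
  by_cases hρ : ρ = 0
  · refine ⟨0, -γ0, fun b hb c hc => ?_⟩
    have h1 := key b0 hb0 γ0 h0 b hb c hc
    subst hρ
    have h3 : γ0 + 0 ^ 2 * c - φ b c = 0 := by
      apply pow_eq_zero_iff (two_ne_zero) |>.1
      rw [h1]; ring
    linear_combination h3
  have hall : ∀ b ∈ dM, ∀ c ∈ Cs b, φ b c = γ b + ρ ^ 2 * c := by
    intro b hb
    let l : F →+ F := (AddMonoidHom.mulLeft (α b)).comp (iterateFrobenius F p (k b)).toAddMonoidHom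
      - AddMonoidHom.mulLeft (ρ ^ 2)
    have hl : ∀ x, l x = α b * x ^ (p ^ (k b)) - ρ ^ 2 * x := by
      intro x
      simp [l, iterateFrobenius_def]
    have hz := s15_additive_two hodd (Cs b) (ε b) (by rw [hcard]; exact hC b hb)
      (by rw [hcard]; exact hε b hb) l (γ0 - γ b + ρ * (b0 - b)) (γ0 - γ b - ρ * (b0 - b)) (by
        intro c hc
        rw [hl]
        have h1 := key b0 hb0 γ0 h0 b hb c hc
        rw [hφ b hb c hc] at h1
        have h2 : (α b * c ^ (p ^ (k b)) - ρ ^ 2 * c - (γ0 - γ b + ρ * (b0 - b))) *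
            (α b * c ^ (p ^ (k b)) - ρ ^ 2 * c - (γ0 - γ b - ρ * (b0 - b))) = 0 := by
          linear_combination h1
        rcases mul_eq_zero.1 h2 with h3 | h3
        · left; exact sub_eq_zero.1 h3
        · right; exact sub_eq_zero.1 h3)
    intro c hc
    have h3 := hz c
    rw [hl] at h3
    rw [hφ b hb c hc]
    linear_combination h3
  have hγ : ∀ b ∈ dM, ∀ b' ∈ dM, (γ b - γ b') ^ 2 = ρ ^ 2 * (b - b') ^ 2 := by
    intro b hb b' hb'
    obtain ⟨c, hc⟩ := hne b' hb'
    have h1 := key b hb (γ b) (hall b hb) b' hb' c hc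
    rw [hall b' hb' c hc] at h1
    linear_combination h1
  have hpm : ∀ b ∈ dM, γ b = γ b0 + ρ * (b - b0) ∨ γ b = γ b0 - ρ * (b - b0) := by
    intro b hb
    have h1 := hγ b hb b0 hb0
    have h2 : (γ b - (γ b0 + ρ * (b - b0))) * (γ b - (γ b0 - ρ * (b - b0))) = 0 := by
      linear_combination h1
    rcases mul_eq_zero.1 h2 with h3 | h3
    · left; exact sub_eq_zero.1 h3
    · right; exact sub_eq_zero.1 h3
  by_cases hp1 : ∀ b ∈ dM, γ b = γ b0 + ρ * (b - b0)
  · refine ⟨ρ, -γ b0 + ρ * b0, fun b hb c hc => ?_⟩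
    rw [hall b hb c hc, hp1 b hb]; ring
  · push Not at hp1
    obtain ⟨b1, hb1, hn1⟩ := hp1
    have hm1 := (hpm b1 hb1).resolve_left hn1
    have hp1 : ∀ b ∈ dM, γ b = γ b0 - ρ * (b - b0) := by
      intro b hb
      rcases hpm b hb with h1 | h1
      · have h2 := hγ b hb b1 hb1
        rw [h1, hm1] at h2
        have h3 : (2 * ρ) ^ 2 * ((b - b0) * (b1 - b0)) = 0 := by linear_combination h2
        have h4 : (b - b0) * (b1 - b0) = 0 := by
          rcases mul_eq_zero.1 h3 with h5 | h5
          · exact absurd h5 (pow_ne_zero _ (mul_ne_zero h2ne hρ))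
          · exact h5
        rcases mul_eq_zero.1 h4 with h5 | h5
        · rw [h1, h5]; ring
        · exact absurd (by rw [hm1, h5]; ring) hn1
      · exact h1
    refine ⟨-ρ, -γ b0 - ρ * b0, fun b hb c hc => ?_⟩
    rw [hall b hb c hc, hp1 b hb]; ring

/-- Let `q > 9` be odd and `U` an intersecting family of polynomials over `F_q` of degree at
most `2`. With `C_b = {c : ∃ a, a + bx + cx² ∈ U}` and `doM = {b : |C_b| > q − √q/2 + 1/2}`,
if `|doM| > q/2` then there exist `α, β ∈ F_q` such that `g(α) = β` for every
`g = a + bx + cx² ∈ U` with `b ∈ doM`. -/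
theorem stmt15 (F : Type*) [Field F] [Fintype F]
    (hodd : Odd (Fintype.card F)) (hq : 9 < Fintype.card F)
    (U : Set (Polynomial F)) (hdeg : ∀ f ∈ U, f.natDegree ≤ 2)
    (hint : ∀ f ∈ U, ∀ g ∈ U, ∃ x : F, f.eval x = g.eval x)
    (doM : Set F)
    (hdoM : doM = {b : F |
      (Fintype.card F : ℝ) - Real.sqrt (Fintype.card F) / 2 + 1 / 2 <
        ({c : F | ∃ a : F, C a + C b * X + C c * X ^ 2 ∈ U}.ncard : ℝ)})
    (hbig : (Fintype.card F : ℝ) / 2 < (doM.ncard : ℝ)) :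
    ∃ α β : F, ∀ a b c : F, b ∈ doM →
      C a + C b * X + C c * X ^ 2 ∈ U →
        (C a + C b * X + C c * X ^ 2 : Polynomial F).eval α = β := by
  classical
  obtain ⟨p, hchar⟩ := CharP.exists F
  obtain ⟨n, hp, hcard⟩ := FiniteField.card F p
  haveI : Fact p.Prime := ⟨hp⟩
  have hp2 : p ≠ 2 := by
    rintro rfl
    rw [hcard, Nat.odd_pow_iff n.ne_zero] at hodd
    exact absurd hodd (by decide)
  let dM : Finset F := Finset.univ.filter (fun b => b ∈ doM)
  have hdM : ∀ b, b ∈ dM ↔ b ∈ doM := by intro b; simp [dM]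
  have hdMc : doM.ncard = dM.card := by
    rw [← Set.ncard_coe_finset]; congr 1; ext b; simp [dM]
  let Cs : F → Finset F := fun b => Finset.univ.filter
    (fun c => ∃ a : F, C a + C b * X + C c * X ^ 2 ∈ U)
  have hCs : ∀ b c, c ∈ Cs b ↔ ∃ a : F, C a + C b * X + C c * X ^ 2 ∈ U := by
    intro b c; simp [Cs]
  have hCsc : ∀ b, {c : F | ∃ a : F, C a + C b * X + C c * X ^ 2 ∈ U}.ncard = (Cs b).card := by
    intro b
    rw [← Set.ncard_coe_finset]; congr 1; ext c; simp [Cs]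
  have hdisc : ∀ a b c a' b' c' : F, C a + C b * X + C c * X ^ 2 ∈ U →
      C a' + C b' * X + C c' * X ^ 2 ∈ U →
      ∃ x : F, a + b * x + c * x ^ 2 = a' + b' * x + c' * x ^ 2 := by
    intro a b c a' b' c' h1 h2
    obtain ⟨x, hx⟩ := hint _ h1 _ h2
    refine ⟨x, ?_⟩
    simpa using hx
  have hf : ∀ b c : F, ∃ a : F, c ∈ Cs b → C a + C b * X + C c * X ^ 2 ∈ U := by
    intro b c
    by_cases hc : c ∈ Cs b
    · obtain ⟨a, ha⟩ := (hCs b c).1 hc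
      exact ⟨a, fun _ => ha⟩
    · exact ⟨0, fun hh => absurd hh hc⟩
  choose f hf using hf
  have hle : ∀ b, (Cs b).card ≤ Fintype.card F := fun b => Finset.card_le_univ _
  obtain ⟨A, B, hAB⟩ := s15_final p n hp2 hcard (by rw [← hcard]; exact hq) dM Cs
    (fun b => Fintype.card F - (Cs b).card) (fun b c => - f b c)
    (by intro b _; have := hle b; rw [← hcard]; omega)
    (by
      intro b hb
      rw [hdM, hdoM, Set.mem_ofPred_eq, hCsc] at hb
      rw [← hcard]
      obtain ⟨e, he⟩ := Nat.exists_eq_add_of_le (hle b)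
      have he2 : Fintype.card F - (Cs b).card = e := by omega
      rw [he2]
      have he3 : (Fintype.card F : ℝ) = (Cs b).card + e := by exact_mod_cast he
      have h1 : (2 * e + 1 : ℝ) < Real.sqrt (Fintype.card F) := by
        have h4 : ((Cs b).card : ℝ) = (Fintype.card F : ℝ) - e := by linarith
        rw [h4] at hb
        linarith
      have h2 : (2 * e + 1 : ℝ) ^ 2 < (Fintype.card F : ℝ) :=
        (Real.lt_sqrt (by positivity)).1 h1
      exact_mod_cast h2)
    (by
      intro b _ b' _ c hc c' hc'
      obtain ⟨x, hx⟩ := hdisc _ _ _ _ _ _ (hf b c hc) (hf b' c' hc')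
      refine ⟨2 * (c - c') * x + (b - b'), ?_⟩
      linear_combination (-4) * (c - c') * hx)
    (by
      rw [← hcard, ← hdMc]
      have : (Fintype.card F : ℝ) < 2 * (doM.ncard : ℝ) := by linarith
      exact_mod_cast this)
  refine ⟨A, B, fun a b c hb hmem => ?_⟩
  have hc : c ∈ Cs b := (hCs b c).2 ⟨a, hmem⟩
  have h1 := hAB b ((hdM b).2 hb) c hc
  obtain ⟨x, hx⟩ := hdisc _ _ _ _ _ _ hmem (hf b c hc)
  have h2 : a = f b c := by linear_combination hx
  simp only [eval_add, eval_mul, eval_C, eval_X, eval_pow]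
  rw [h2]
  linear_combination h1
end

section
/- Let q > 2 be even and let U be an intersecting family of polynomials over F_q of degree at most 2. For t ∈ F_q let B_t = {b ∈ F_q : there exists a ∈ F_q with a + bx + (b+t)x^2 ∈ U}, and let Dom = {t ∈ F_q : |B_t| ≥ q − √q/2}. Then for every t ∈ Dom there exist A(t), B(t) ∈ F_q with Tr_{q/2}(A(t)) = 0 such that for every b ∈ B_t, the (unique) constant term a of the element a + bx + (b+t)x^2 of U equals A(t)·b + B(t). -/
open Polynomial

/-- The absolute trace. -/
def trc {F : Type*} [Field F] (n : ℕ) (x : F) : F := ∑ i ∈ Finset.range n, x ^ 2 ^ i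

/-- A monic polynomial over a domain with enough distinct roots splits. -/
lemma split_of_roots {R ι : Type*} [CommRing R] [IsDomain R] (p : R[X]) (hp : p.Monic)
    (s : Finset ι) (η : ι → R) (hinj : Set.InjOn η s) (hdeg : p.natDegree = s.card)
    (hroot : ∀ z ∈ s, p.eval (η z) = 0) : p = ∏ z ∈ s, (X - C (η z)) := by
  classical
  have h1 : ∏ z ∈ s, (X - C (η z)) = ((s.image η).val.map fun a => X - C a).prod := by
    have : ∏ z ∈ s, (X - C (η z)) = ∏ a ∈ s.image η, (X - C a) := by
      rw [Finset.prod_image hinj]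
    rw [this]; rfl
  refine eq_of_monic_of_dvd_of_natDegree_le (monic_prod_X_sub_C _ _) hp ?_ ?_
  · rw [h1, Multiset.prod_X_sub_C_dvd_iff_le_roots hp.ne_zero,
      Multiset.le_iff_subset (s.image η).nodup]
    intro a ha
    have ha' : a ∈ s.image η := ha
    obtain ⟨z, hz, rfl⟩ := Finset.mem_image.1 ha'
    exact (mem_roots hp.ne_zero).2 (hroot z hz)
  · rw [hdeg, natDegree_finsetProd_X_sub_C_eq_card]

/-- The quotient of `X ^ N` by a Rédei polynomial, with degree control of the coefficients. -/
lemma exists_quotient {F : Type*} [Field F] (N : ℕ) (u : F → F[X])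
    (hu : ∀ b, (u b).natDegree ≤ 1) (S : Finset F) (hS : S.card ≤ N) :
    ∃ f g : F[X][X], f.Monic ∧ f.natDegree = N - S.card ∧
      (∀ i, i ≤ N - S.card → (f.coeff i).natDegree ≤ N - S.card - i) ∧
      X ^ N = (∏ b ∈ S, (X - C (u b))) * f + g ∧ g.degree < S.card := by
  classical
  induction S using Finset.induction_on with
  | empty =>
    refine ⟨X ^ N, 0, monic_X_pow _, by simp, ?_, by simp, by simp⟩
    intro i hi
    rw [coeff_X_pow]
    split_ifs <;> simp
  | insert c S hc ih =>
    rw [Finset.card_insert_of_notMem hc] at hS ⊢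
    obtain ⟨f, g, hf, hfd, hfc, hfg, hg⟩ := ih (by omega)
    have hm : (X - C (u c)).Monic := monic_X_sub_C _
    have hdeg : (X - C (u c)).degree ≤ f.degree := by
      rw [degree_X_sub_C, degree_eq_natDegree hf.ne_zero, hfd]
      exact_mod_cast (by omega : 1 ≤ N - S.card)
    refine ⟨f /ₘ (X - C (u c)), (∏ b ∈ S, (X - C (u b))) * C (f.eval (u c)) + g, ?_, ?_, ?_, ?_, ?_⟩
    · rw [Monic, leadingCoeff_divByMonic_of_monic hm hdeg, hf]
    · rw [natDegree_divByMonic _ hm, natDegree_X_sub_C, hfd]; omega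
    · intro i hi
      rw [coeff_divByMonic_X_sub_C]
      refine natDegree_sum_le_of_forall_le _ _ ?_
      intro j hj
      rw [Finset.mem_Icc, hfd] at hj
      refine natDegree_mul_le.trans ?_
      have h1 := hfc j hj.2
      have h2 : (u c ^ (j - (i + 1))).natDegree ≤ (j - (i + 1)) * 1 :=
        natDegree_pow_le_of_le _ (hu c)
      omega
    · rw [Finset.prod_insert hc]
      have := modByMonic_add_div f (X - C (u c))
      rw [modByMonic_X_sub_C_eq_C_eval] at this
      conv_lhs => rw [hfg, ← this]
      ring
    · refine lt_of_le_of_lt (degree_add_le _ _) ?_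
      have h0 : (∏ b ∈ S, (X - C (u b))).degree = ((S.card : ℕ) : WithBot ℕ) := by
        rw [degree_eq_natDegree (monic_prod_X_sub_C _ _).ne_zero,
          natDegree_finsetProd_X_sub_C_eq_card]
      have hlt : ((S.card : ℕ) : WithBot ℕ) < ((S.card + 1 : ℕ) : WithBot ℕ) := by
        exact_mod_cast Nat.lt_succ_self _
      refine max_lt ?_ (hg.trans hlt)
      refine lt_of_le_of_lt (degree_mul_le _ _) ?_
      rw [h0]
      refine lt_of_le_of_lt ?_ hlt
      calc (S.card : WithBot ℕ) + (C (f.eval (u c))).degree ≤ S.card + 0 := by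
            gcongr; exact degree_C_le
        _ = _ := by simp

/-- degree bound for evaluation of a polynomial with weighted coefficient bound -/
lemma natDegree_eval_le {F : Type*} [Field F] (m : ℕ) (f : F[X][X]) (hfd : f.natDegree = m)
    (hfc : ∀ i, i ≤ m → (f.coeff i).natDegree ≤ m - i) (l : F[X]) (hl : l.natDegree ≤ 1) :
    (f.eval l).natDegree ≤ m := by
  rw [eval_eq_sum_range]
  refine natDegree_sum_le_of_forall_le _ _ ?_
  intro i hi
  rw [Finset.mem_range, hfd] at hi
  refine natDegree_mul_le.trans ?_
  have h1 := hfc i (by omega)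
  have h2 : (l ^ i).natDegree ≤ i * 1 := natDegree_pow_le_of_le _ hl
  omega

lemma sum_eval_eq_zero {F : Type*} [Field F] [Fintype F] (p : F[X])
    (hp : p.natDegree < Fintype.card F - 1) : ∑ c : F, p.eval c = 0 := by
  simp_rw [eval_eq_sum_range]
  rw [Finset.sum_comm]
  refine Finset.sum_eq_zero fun i hi => ?_
  rw [← Finset.mul_sum, FiniteField.sum_pow_lt_card_sub_one F i, mul_zero]
  rw [Finset.mem_range] at hi
  omega

/-- Specialisation of the quotient. -/
lemma quotient_eval {F : Type*} [Field F] [Fintype F] [DecidableEq F] (u : F → F[X])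
    (S : Finset F) (hS : 1 < S.card) (f g : F[X][X])
    (hfg : X ^ (Fintype.card F) = (∏ b ∈ S, (X - C (u b))) * f + g) (hg : g.degree < S.card)
    (t : F) (hinj : Set.InjOn (fun b => (u b).eval t) S) :
    f.map (evalRingHom t) = ∏ c ∈ (S.image (fun b => (u b).eval t))ᶜ, (X - C c) := by
  set I := S.image (fun b => (u b).eval t) with hI
  have h1 : (∏ b ∈ S, (X - C ((u b).eval t))) = ∏ c ∈ I, (X - C c) := by
    rw [hI, Finset.prod_image hinj]
  have h2 : (X : F[X]) ^ (Fintype.card F) - X = ∏ c : F, (X - C c) := by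
    have hc := Fintype.one_lt_card (α := F)
    refine split_of_roots _ ?_ Finset.univ id (Set.injOn_id _) ?_ ?_
    · exact monic_X_pow_sub (by rw [degree_X]; exact_mod_cast hc)
    · rw [FiniteField.X_pow_card_sub_X_natDegree_eq F hc]; rfl
    · intro z _; simp [FiniteField.pow_card]
  rw [← Finset.prod_mul_prod_compl I] at h2
  have h3 := congrArg (Polynomial.map (evalRingHom t)) hfg
  simp only [Polynomial.map_pow, map_X, Polynomial.map_add, Polynomial.map_mul,
    Polynomial.map_prod, Polynomial.map_sub, map_C, coe_evalRingHom] at h3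
  rw [h1] at h3
  by_contra hne
  have h4 : (∏ c ∈ I, (X - C c)) * (f.map (evalRingHom t) - ∏ c ∈ Iᶜ, (X - C c))
      = X - g.map (evalRingHom t) := by
    rw [mul_sub, ← h2, h3]; ring
  have h5 : (∏ c ∈ I, (X - C c)).degree = ((S.card : ℕ) : WithBot ℕ) := by
    rw [degree_eq_natDegree (monic_prod_X_sub_C _ _).ne_zero,
          natDegree_finsetProd_X_sub_C_eq_card, hI, Finset.card_image_of_injOn hinj]
  have h6 : (X - g.map (evalRingHom t)).degree < ((S.card : ℕ) : WithBot ℕ) := by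
    refine lt_of_le_of_lt (degree_sub_le _ _) (max_lt ?_ ?_)
    · rw [degree_X]; exact_mod_cast hS
    · exact lt_of_le_of_lt degree_map_le hg
  rw [← h4, degree_mul, h5] at h6
  have h7 : 0 ≤ (f.map (evalRingHom t) - ∏ c ∈ Iᶜ, (X - C c)).degree :=
    zero_le_degree_iff.2 (sub_ne_zero.2 hne)
  have h8 : (S.card : WithBot ℕ) ≤ S.card + (f.map (evalRingHom t) - ∏ c ∈ Iᶜ, (X - C c)).degree := by
    calc (S.card : WithBot ℕ) = S.card + 0 := by simp
      _ ≤ _ := by gcongr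
  exact absurd h6 (not_lt.2 h8)

/-- Vanishing of the weighted moments. -/
lemma moment_vanish {F : Type*} [Field F] [Fintype F] [DecidableEq F] (u : F → F[X])
    (hu : ∀ b, (u b).natDegree ≤ 1) (m d : ℕ) (hd : d < Fintype.card F - 1)
    (S : Finset F) (hS : 1 < S.card) (f g : F[X][X]) (hfd : f.natDegree = m)
    (hfc : ∀ i, i ≤ m → (f.coeff i).natDegree ≤ m - i)
    (hfg : X ^ (Fintype.card F) = (∏ b ∈ S, (X - C (u b))) * f + g) (hg : g.degree < S.card)
    (Θ : Finset F) (hΘ : d < Θ.card)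
    (hinj : ∀ t ∈ Θ, Set.InjOn (fun b => (u b).eval t) S) (k : ℕ) (hk : m + k ≤ d) :
    ∑ b ∈ S, f.eval (u b) * u b ^ k = 0 := by
  refine eq_zero_of_natDegree_lt_card_of_eval_eq_zero' _ Θ ?_ ?_
  · intro t ht
    have hq := quotient_eval u S hS f g hfg hg t (hinj t ht)
    have he : ∀ b, (f.eval (u b)).eval t = (f.map (evalRingHom t)).eval ((u b).eval t) := by
      intro b
      have := Polynomial.eval_map_apply (evalRingHom t) (u b) (p := f)
      simpa using this.symm
    rw [eval_finsetSum]
    simp only [eval_mul, eval_pow, he]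
    have hz := sum_eval_eq_zero (f.map (evalRingHom t) * X ^ k) (by
      refine lt_of_le_of_lt natDegree_mul_le ?_
      have := natDegree_map_le (f := evalRingHom t) (p := f)
      rw [natDegree_X_pow]; omega)
    rw [← Finset.sum_add_sum_compl (S.image (fun b => (u b).eval t)),
      Finset.sum_image (hinj t ht)] at hz
    rw [Finset.sum_eq_zero (s := (S.image (fun b => (u b).eval t))ᶜ), add_zero] at hz
    · simpa using hz
    · intro c hc
      rw [eval_mul, hq, eval_prod, Finset.prod_eq_zero hc (by simp), zero_mul]
  · refine lt_of_le_of_lt (natDegree_sum_le_of_forall_le _ _ (n := d) ?_) hΘ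
    intro b _
    refine natDegree_mul_le.trans ?_
    have h1 := natDegree_eval_le m f hfd hfc (u b) (hu b)
    have h2 : (u b ^ k).natDegree ≤ k * 1 := natDegree_pow_le_of_le _ (hu b)
    omega

/-- Hensel factorisation over the power series ring. -/
lemma hensel_factor {F : Type*} [Field F] (f : (PowerSeries F)[X]) (hf : f.Monic) (s : Finset F)
    (hs : f.map (PowerSeries.constantCoeff (R := F)) = ∏ z ∈ s, (X - C z)) :
    ∃ η : F → PowerSeries F, (∀ z ∈ s, PowerSeries.constantCoeff (η z) = z) ∧
      f = ∏ z ∈ s, (X - C (η z)) := by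
  classical
  have key : ∀ z ∈ s, ∃ a : PowerSeries F, f.eval a = 0 ∧ PowerSeries.constantCoeff a = z := by
    intro z hz
    have hev : ∀ p : (PowerSeries F)[X], PowerSeries.constantCoeff (p.eval (PowerSeries.C z))
        = (p.map (PowerSeries.constantCoeff (R := F))).eval z := by
      intro p
      have := Polynomial.eval_map_apply (PowerSeries.constantCoeff (R := F)) (PowerSeries.C z) (p := p)
      rw [← this]; simp
    have hsep : (∏ z ∈ s, (X - C z)).Separable :=
      separable_prod_X_sub_C_iff'.2 (fun x _ y _ h => h)
    obtain ⟨a, ha, ha'⟩ := HenselianRing.is_henselian (I := Ideal.span {(PowerSeries.X : PowerSeries F)})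
      f hf (PowerSeries.C z) (by
        rw [Ideal.mem_span_singleton, PowerSeries.X_dvd_iff, hev, hs, eval_prod]
        exact Finset.prod_eq_zero hz (by simp)) (by
        refine IsUnit.map _ ?_
        rw [PowerSeries.isUnit_iff_constantCoeff, hev, ← derivative_map, hs, isUnit_iff_ne_zero]
        have := hsep.eval₂_derivative_ne_zero (RingHom.id F) (x := z) (by
          rw [eval₂_id, eval_prod]; exact Finset.prod_eq_zero hz (by simp))
        rwa [eval₂_id] at this)
    refine ⟨a, ha, ?_⟩
    rw [Ideal.mem_span_singleton, PowerSeries.X_dvd_iff, map_sub, PowerSeries.constantCoeff_C,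
      sub_eq_zero] at ha'
    exact ha'
  choose! η h1 h2 using key
  refine ⟨η, h2, split_of_roots f hf s η ?_ ?_ h1⟩
  · intro x hx y hy hxy
    rw [← h2 x hx, ← h2 y hy, hxy]
  · rw [← hf.natDegree_map (PowerSeries.constantCoeff (R := F)), hs,
      natDegree_finsetProd_X_sub_C_eq_card]

/-- The key step: the missing points lie on lines. -/
lemma core_line {F : Type*} [Field F] [Fintype F] [DecidableEq F] [CharP F 2]
    (S : Finset F) (a : F → F) (u : F → F[X]) (hu : ∀ b, u b = C b - C (a b) * X)
    (m d e : ℕ) (hm : Sᶜ.card = m) (hmQ : m < 2 ^ e) (hQd : 2 ^ e * (m - 1) + 1 ≤ d)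
    (hd : d < Fintype.card F - 1)
    (f : F[X][X]) (hf : f.Monic) (hfd : f.natDegree = m)
    (hfc : ∀ i, i ≤ m → (f.coeff i).natDegree ≤ m - i)
    (hf0 : f.map (evalRingHom 0) = ∏ z ∈ Sᶜ, (X - C z))
    (hmom : ∀ k, m + k ≤ d → ∑ b ∈ S, f.eval (u b) * u b ^ k = 0)
    (z : F) (hz : z ∈ Sᶜ) : ∃ β : F, f.eval (C z - C β * X) = 0 := by
  have : CharP (PowerSeries F) 2 := charP_of_injective_ringHom (PowerSeries.C_injective (R := F)) 2
  set Q := 2 ^ e with hQ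
  set φ : F[X] →+* PowerSeries F := coeToPowerSeries.ringHom with hφ
  have hφX : φ X = PowerSeries.X := by simp [hφ]
  have hφC : ∀ c, φ (C c) = PowerSeries.C c := by intro c; simp [hφ]
  have hm1 : 1 ≤ m := by rw [← hm]; exact Finset.card_pos.2 ⟨z, hz⟩
  have hφ0 : (PowerSeries.constantCoeff (R := F)).comp φ = evalRingHom 0 := by
    ext x <;> simp [hφ]
  obtain ⟨η, hη, hfac⟩ := hensel_factor (f.map φ) (hf.map φ) Sᶜ (by
    rw [Polynomial.map_map, hφ0, hf0])
  set E := Sᶜ.erase z with hE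
  have hEc : E.card = m - 1 := by rw [hE, Finset.card_erase_of_mem hz, hm]
  set Lz : (PowerSeries F)[X] := ∏ w ∈ E, (X - C (η w)) with hLz
  have hfac2 : f.map φ = (X - C (η z)) * Lz := by
    rw [hfac, ← Finset.mul_prod_erase _ _ hz]
  have hmomG : ∀ G : (PowerSeries F)[X], m + G.natDegree ≤ d →
      ∑ b ∈ S, (f.map φ).eval (φ (u b)) * G.eval (φ (u b)) = 0 := by
    intro G hG
    simp_rw [eval_eq_sum_range (p := G), Finset.mul_sum]
    rw [Finset.sum_comm]
    refine Finset.sum_eq_zero fun k hk => ?_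
    have := congrArg φ (hmom k (by rw [Finset.mem_range] at hk; omega))
    rw [map_sum, map_zero] at this
    rw [← mul_zero (G.coeff k), ← this, Finset.mul_sum]
    refine Finset.sum_congr rfl fun b _ => ?_
    rw [map_mul, map_pow, ← Polynomial.eval_map_apply φ]
    ring
  have hQ1 : 1 ≤ Q := Nat.one_le_two_pow
  have hid : (X - C (η z)) * Lz ^ Q = f.map φ * Lz ^ (Q - 1) := by
    rw [hfac2, mul_assoc, ← pow_succ', Nat.sub_add_cancel hQ1]
  have hLd : Lz.natDegree = m - 1 := by rw [hLz, natDegree_finsetProd_X_sub_C_eq_card, hEc]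
  have hsum := hmomG (Lz ^ (Q - 1)) (by
    refine le_trans ?_ hQd
    have h1 : (Lz ^ (Q - 1)).natDegree ≤ (Q - 1) * (m - 1) := natDegree_pow_le_of_le _ hLd.le
    obtain ⟨Q', hQ'⟩ : ∃ Q', Q = Q' + 1 := ⟨Q - 1, by omega⟩
    obtain ⟨m', hm'⟩ : ∃ m', m = m' + 1 := ⟨m - 1, by omega⟩
    rw [hQ', hm'] at h1 ⊢
    simp only [Nat.add_sub_cancel] at h1 ⊢
    nlinarith)
  simp_rw [← eval_mul, ← hid] at hsum
  -- reduction modulo `X ^ Q`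
  set v : F → F := fun b => ∏ w ∈ E, (b - w) ^ Q with hv
  set W : F → PowerSeries F := fun b => (Lz ^ Q).eval (φ (u b)) with hW
  set I : Ideal (PowerSeries F) := Ideal.span {PowerSeries.X ^ Q} with hI
  have hWv : ∀ b, W b - PowerSeries.C (v b) ∈ I := by
    intro b
    rw [← Ideal.Quotient.eq]
    simp only [hW, hv, hLz, eval_pow, eval_prod, ← Finset.prod_pow, map_prod]
    refine Finset.prod_congr rfl fun w hw => ?_
    rw [Ideal.Quotient.eq, map_pow, hQ, ← sub_pow_char_pow, ← hQ, Ideal.mem_span_singleton]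
    refine pow_dvd_pow_of_dvd ?_ Q
    rw [PowerSeries.X_dvd_iff]
    have hw' : w ∈ Sᶜ := (Finset.mem_erase.1 hw).2
    simp [hu, hφX, hφC, hη w hw']
  have hκ : ∑ b ∈ S, v b = - v z := by
    have h1 := sum_eval_eq_zero ((∏ w ∈ E, (X - C w)) ^ Q) (by
      refine lt_of_le_of_lt (natDegree_pow_le_of_le Q
        (natDegree_finsetProd_X_sub_C_eq_card E (fun w => w)).le) ?_
      rw [hEc]; omega)
    have h2 : ∀ c, ((∏ w ∈ E, (X - C w)) ^ Q).eval c = v c := by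
      intro c; simp [hv, eval_prod, Finset.prod_pow]
    simp_rw [h2] at h1
    rw [← Finset.sum_add_sum_compl S, ← Finset.add_sum_erase _ _ hz,
      Finset.sum_eq_zero (s := Sᶜ.erase z), add_zero] at h1
    · exact eq_neg_of_add_eq_zero_left h1
    · intro x hx
      exact Finset.prod_eq_zero hx (by rw [sub_self, zero_pow (by omega)])
  have hvz : v z ≠ 0 := by
    refine Finset.prod_ne_zero_iff.2 fun w hw => pow_ne_zero _ ?_
    exact sub_ne_zero.2 (Finset.mem_erase.1 hw).1.symm
  set κ := ∑ b ∈ S, v b with hκd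
  have hκ0 : κ ≠ 0 := by rw [hκ]; exact neg_ne_zero.2 hvz
  set l : F[X] := C κ⁻¹ * ∑ b ∈ S, C (v b) * u b with hl
  have hleq : φ l - η z ∈ I := by
    have h1 : ∑ b ∈ S, (φ (u b) - η z) * W b = 0 := by
      rw [← hsum]; refine Finset.sum_congr rfl fun b _ => by simp [hW]
    have h2 : ∑ b ∈ S, (φ (u b) - η z) * PowerSeries.C (v b) ∈ I := by
      have h3 : ∑ b ∈ S, (φ (u b) - η z) * (PowerSeries.C (v b) - W b) ∈ I :=
        Ideal.sum_mem _ fun b _ => Ideal.mul_mem_left _ _ (by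
          rw [← neg_sub]; exact I.neg_mem (hWv b))
      simp_rw [mul_sub] at h3
      rw [Finset.sum_sub_distrib] at h3
      rwa [h1, sub_zero] at h3
    have h4 : φ l - η z = PowerSeries.C κ⁻¹ * ∑ b ∈ S, (φ (u b) - η z) * PowerSeries.C (v b) := by
      simp_rw [sub_mul]
      rw [Finset.sum_sub_distrib, ← Finset.mul_sum, ← map_sum, ← hκd, mul_sub, hl, map_mul, map_sum,
        hφC]
      have : PowerSeries.C κ⁻¹ * (η z * PowerSeries.C κ) = η z := by
        rw [mul_left_comm, ← map_mul, inv_mul_cancel₀ hκ0, map_one, mul_one]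
      rw [this]
      congr 2
      refine Finset.sum_congr rfl fun b _ => ?_
      rw [map_mul, hφC, mul_comm]
    rw [h4]
    exact Ideal.mul_mem_left _ _ h2
  have hul : ∀ b, (u b).natDegree ≤ 1 := by
    intro b; rw [hu]; compute_degree
  have hld : l.natDegree ≤ 1 := by
    rw [hl]
    refine (natDegree_C_mul_le _ _).trans (natDegree_sum_le_of_forall_le _ _ fun b _ => ?_)
    exact (natDegree_C_mul_le _ _).trans (hul b)
  have hfl : f.eval l = 0 := by
    have h1 : φ (f.eval l) ∈ I := by
      have h2 : (f.map φ).eval (η z) = 0 := by rw [hfac2]; simp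
      have h3 := Polynomial.sub_dvd_eval_sub (φ l) (η z) (f.map φ)
      rw [h2, sub_zero, Polynomial.eval_map_apply] at h3
      exact I.mem_of_dvd h3 hleq
    rw [hI, Ideal.mem_span_singleton, PowerSeries.X_pow_dvd_iff] at h1
    ext i
    by_cases hi : i < Q
    · simpa [hφ] using h1 i hi
    · rw [coeff_zero]
      refine coeff_eq_zero_of_natDegree_lt ?_
      have := natDegree_eval_le m f hfd hfc l hld
      omega
  have hl0 : l.coeff 0 = z := by
    rw [hI, Ideal.mem_span_singleton, PowerSeries.X_pow_dvd_iff] at hleq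
    have := hleq 0 (by omega)
    rw [map_sub, PowerSeries.coeff_zero_eq_constantCoeff_apply,
      PowerSeries.coeff_zero_eq_constantCoeff_apply, hη z hz, sub_eq_zero] at this
    simpa [hφ] using this
  refine ⟨-l.coeff 1, ?_⟩
  rw [← hfl]
  congr 1
  rw [eq_X_add_C_of_natDegree_le_one hld]
  simp [hl0]
  ring

lemma trc_zero {F : Type*} [Field F] (n : ℕ) : trc n (0 : F) = 0 := by
  refine Finset.sum_eq_zero fun i _ => ?_
  exact zero_pow (by positivity)

/-- The set of nonzero-trace elements is large. -/
lemma card_trc {F : Type*} [Field F] [Fintype F] [DecidableEq F] (n : ℕ) (hn : 1 ≤ n)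
    (hcard : Fintype.card F = 2 ^ n) :
    2 ^ (n - 1) ≤ (Finset.univ.filter fun y : F => trc n y ≠ 0).card := by
  set p : F[X] := ∑ i ∈ Finset.range n, X ^ 2 ^ i with hp
  have hpe : ∀ y, p.eval y = trc n y := by
    intro y; simp [hp, trc, eval_finsetSum]
  have hpd : p.natDegree ≤ 2 ^ (n - 1) := by
    refine natDegree_sum_le_of_forall_le _ _ fun i hi => ?_
    rw [natDegree_X_pow]
    rw [Finset.mem_range] at hi
    exact Nat.pow_le_pow_right (by norm_num) (by omega)
  have hp0 : p ≠ 0 := by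
    intro h
    have h1 : p.coeff 1 = 0 := by rw [h, coeff_zero]
    rw [hp, finsetSum_coeff, Finset.sum_eq_single 0] at h1
    · simp at h1
    · intro i _ hi
      rw [coeff_X_pow, if_neg]
      have : 1 < 2 ^ i := Nat.one_lt_two_pow hi
      omega
    · intro h; simp at h; omega
  have h1 : (Finset.univ.filter fun y : F => trc n y = 0).card ≤ 2 ^ (n - 1) := by
    by_contra hlt
    push Not at hlt
    refine hp0 (eq_zero_of_natDegree_lt_card_of_eval_eq_zero' p _ ?_ (lt_of_le_of_lt hpd hlt))
    intro y hy
    rw [hpe]; exact (Finset.mem_filter.1 hy).2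
  have h2 := Finset.card_filter_add_card_filter_not (s := (Finset.univ : Finset F))
    (fun y : F => trc n y = 0)
  rw [Finset.card_univ, hcard] at h2
  have h3 : 2 ^ n = 2 * 2 ^ (n - 1) := by
    rw [← pow_succ']; congr 1; omega
  simp only [ne_eq]
  omega

/-- One step extension. -/
lemma extend_one {F : Type*} [Field F] [Fintype F] [DecidableEq F] [CharP F 2] (n : ℕ)
    (hcard : Fintype.card F = 2 ^ n) (hq : 2 < Fintype.card F) (S : Finset F) (a : F → F)
    (hm1 : 1 ≤ Sᶜ.card) (hm2 : 4 * Sᶜ.card ^ 2 ≤ Fintype.card F)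
    (ha : ∀ b ∈ S, ∀ b' ∈ S, b ≠ b' → trc n ((a b - a b') / (b - b')) = 0) :
    ∃ z ∈ Sᶜ, ∃ β : F, ∀ b ∈ S, trc n ((β - a b) / (z - b)) = 0 := by
  have hn : 2 ≤ n := by
    by_contra h
    have h' : n ≤ 1 := by omega
    have := Nat.pow_le_pow_right (n := 2) (by norm_num) h'
    omega
  have h3 : 2 ^ n = 2 * 2 ^ (n - 1) := by
    rw [← pow_succ']; congr 1; omega
  set m := Sᶜ.card with hm
  set d := 2 ^ (n - 1) with hd
  set q := Fintype.card F with hqd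
  have hcS : S.card + m = q := by rw [hm, Finset.card_compl]; have := Finset.card_le_univ S; omega
  have hSm : S.card = q - m := by omega
  have hSle : S.card ≤ q := by omega
  have hmm : m ≤ m ^ 2 := Nat.le_self_pow (by norm_num) m
  have hS1 : 1 < S.card := by omega
  set u : F → F[X] := fun b => C b - C (a b) * X with hu
  have hud : ∀ b, (u b).natDegree ≤ 1 := by intro b; simp only [hu]; compute_degree
  obtain ⟨f, g, hf, hfd, hfc, hfg, hg⟩ := exists_quotient q u hud S hSle
  have hqS : q - S.card = m := by omega
  rw [hqS] at hfd hfc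
  set Θ : Finset F := insert 0 ((Finset.univ.filter fun y : F => trc n y ≠ 0).image fun y => y⁻¹)
    with hΘ
  have hΘc : d < Θ.card := by
    rw [hΘ, Finset.card_insert_of_notMem, Finset.card_image_of_injective _ inv_injective]
    · have := card_trc (F := F) n (by omega) hcard
      omega
    · intro h
      obtain ⟨y, hy, hy0⟩ := Finset.mem_image.1 h
      rw [inv_eq_zero] at hy0
      rw [hy0] at hy
      exact (Finset.mem_filter.1 hy).2 (trc_zero n)
  have hue : ∀ b t, (u b).eval t = b - a b * t := by intro b t; simp [hu]
  have hinj : ∀ t ∈ Θ, Set.InjOn (fun b => (u b).eval t) S := by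
    intro t ht b hb b' hb' hbb
    simp only [hue] at hbb
    rcases Finset.mem_insert.1 ht with rfl | ht
    · simpa using hbb
    · obtain ⟨y, hy, rfl⟩ := Finset.mem_image.1 ht
      have hy := (Finset.mem_filter.1 hy).2
      by_contra hne
      apply hy
      rw [← ha b hb b' hb' hne]
      have hy0 : y ≠ 0 := by rintro rfl; exact hy (trc_zero n)
      congr 1
      rw [eq_div_iff (sub_ne_zero.2 hne)]
      field_simp at hbb
      linear_combination hbb
  have hdq : d < q - 1 := by
    have : 2 ≤ d := by rw [hd]; exact Nat.le_self_pow (by omega) 2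
    omega
  have hmom := moment_vanish u hud m d hdq S hS1 f g hfd hfc hfg hg Θ hΘc hinj
  have hf0 : f.map (evalRingHom 0) = ∏ z ∈ Sᶜ, (X - C z) := by
    have := quotient_eval u S hS1 f g hfg hg 0 (hinj 0 (Finset.mem_insert_self _ _))
    rw [this]
    have himg : S.image (fun b => (u b).eval 0) = S := by simp [hue]
    rw [himg]
  obtain ⟨z, hz⟩ := Finset.card_pos.1 (by omega : 0 < Sᶜ.card)
  -- the power of two
  have hlog1 : 2 ^ Nat.log 2 m ≤ m := Nat.pow_log_le_self 2 (by omega)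
  have hlog2 : m < 2 ^ (Nat.log 2 m + 1) := Nat.lt_pow_succ_log_self (by norm_num) m
  have hQd : 2 ^ (Nat.log 2 m + 1) * (m - 1) + 1 ≤ d := by
    have h5 : 2 ^ (Nat.log 2 m + 1) ≤ 2 * m := by rw [pow_succ]; omega
    obtain ⟨m', hm'⟩ : ∃ m', m = m' + 1 := ⟨m - 1, by omega⟩
    have h6 : 2 ^ (Nat.log 2 m + 1) * (m - 1) ≤ 2 * m * (m - 1) := Nat.mul_le_mul_right _ h5
    have h7 : 2 * m ^ 2 ≤ d := by omega
    rw [hm'] at h7 h6 ⊢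
    simp only [Nat.add_sub_cancel] at h6 ⊢
    nlinarith
  obtain ⟨β, hβ⟩ := core_line S a u (fun b => rfl) m d _ hm.symm hlog2 hQd hdq f hf hfd hfc hf0 hmom z hz
  refine ⟨z, hz, β, fun b hb => ?_⟩
  by_contra hne
  set y := (β - a b) / (z - b) with hy
  have hy0 : y ≠ 0 := by intro h; exact hne (by rw [h]; exact trc_zero n)
  have hzb : z - b ≠ 0 := by intro h; rw [h, div_zero] at hy; exact hy0 hy
  have ht : y⁻¹ ∈ Θ := Finset.mem_insert_of_mem (Finset.mem_image.2
    ⟨y, Finset.mem_filter.2 ⟨Finset.mem_univ _, hne⟩, rfl⟩)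
  have h8 := quotient_eval u S hS1 f g hfg hg y⁻¹ (hinj _ ht)
  have h9 : (f.map (evalRingHom y⁻¹)).eval (z - β * y⁻¹) = 0 := by
    have := Polynomial.eval_map_apply (evalRingHom y⁻¹) (C z - C β * X) (p := f)
    rw [hβ] at this
    simpa using this
  rw [h8, eval_prod, Finset.prod_eq_zero_iff] at h9
  obtain ⟨c, hc, hc0⟩ := h9
  rw [eval_sub, eval_X, eval_C, sub_eq_zero] at hc0
  rw [Finset.mem_compl] at hc
  apply hc
  refine Finset.mem_image.2 ⟨b, hb, ?_⟩
  rw [← hc0]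
  simp only [hue]
  have h10 : y * (z - b) = β - a b := by rw [hy, div_mul_cancel₀ _ hzb]
  field_simp
  linear_combination -h10

/-- Full extension. -/
lemma extend_all {F : Type*} [Field F] [Fintype F] [DecidableEq F] [CharP F 2] (n : ℕ)
    (hcard : Fintype.card F = 2 ^ n) (hq : 2 < Fintype.card F) (k : ℕ) : ∀ (S : Finset F) (a : F → F),
    Sᶜ.card = k → 4 * k ^ 2 ≤ Fintype.card F →
    (∀ b ∈ S, ∀ b' ∈ S, b ≠ b' → trc n ((a b - a b') / (b - b')) = 0) →
    ∃ a' : F → F, (∀ b ∈ S, a' b = a b) ∧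
      ∀ b b', b ≠ b' → trc n ((a' b - a' b') / (b - b')) = 0 := by
  induction k with
  | zero =>
    intro S a hS _ ha
    have : S = Finset.univ := by
      rw [Finset.card_eq_zero, Finset.compl_eq_empty_iff] at hS; exact hS
    subst this
    exact ⟨a, fun _ _ => rfl, fun b b' h => ha b (Finset.mem_univ _) b' (Finset.mem_univ _) h⟩
  | succ k ih =>
    intro S a hS hk ha
    obtain ⟨z, hz, β, hβ⟩ := extend_one n hcard hq S a (by omega) (by rw [hS]; exact hk) ha
    have hzS : z ∉ S := Finset.mem_compl.1 hz
    have hup : ∀ b ∈ S, Function.update a z β b = a b := by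
      intro b hb
      exact Function.update_of_ne (by rintro rfl; exact hzS hb) _ _
    obtain ⟨a', h1, h2⟩ := ih (insert z S) (Function.update a z β) (by
      rw [Finset.compl_insert, Finset.card_erase_of_mem hz, hS]; rfl) (by nlinarith) (by
      intro b hb b' hb' hne
      rcases Finset.mem_insert.1 hb with hbz | hb1
      · rcases Finset.mem_insert.1 hb' with hbz' | hb1'
        · exact absurd (hbz.trans hbz'.symm) hne
        · rw [hup b' hb1', hbz, Function.update_self]
          exact hβ b' hb1'
      · rcases Finset.mem_insert.1 hb' with hbz' | hb1'
        · rw [hup b hb1, hbz', Function.update_self, ← neg_sub β, ← neg_sub z, neg_div_neg_eq]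
          exact hβ b hb1
        · rw [hup b hb1, hup b' hb1']
          exact ha b hb1 b' hb1' hne)
    exact ⟨a', fun b hb => by rw [h1 b (Finset.mem_insert_of_mem hb), hup b hb], h2⟩

lemma sum_pow_all {F : Type*} [Field F] [Fintype F] (k : ℕ) (hk : 0 < k)
    (hk2 : k < 2 * (Fintype.card F - 1)) :
    ∑ u : F, u ^ k = if k = Fintype.card F - 1 then -1 else 0 := by
  classical
  have h1 : ∑ u : F, u ^ k = ∑ u : Fˣ, ((u ^ k : Fˣ) : F) := by
    rw [← Finset.sum_subset (Finset.subset_univ (Finset.univ.image (fun u : Fˣ => (u : F))))]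
    · rw [Finset.sum_image (by intro x _ y _ h; exact Units.ext h)]
      simp
    · intro x _ hx
      have : x = 0 := by
        by_contra h
        exact hx (Finset.mem_image.2 ⟨Units.mk0 x h, Finset.mem_univ _, rfl⟩)
      rw [this, zero_pow hk.ne']
  rw [h1]
  have h2 := FiniteField.sum_pow_units F k
  push_cast at h2 ⊢
  rw [h2]
  congr 1
  apply propext
  constructor
  · rintro ⟨c, hc⟩
    have : c < 2 := by
      by_contra h
      have : (Fintype.card F - 1) * 2 ≤ (Fintype.card F - 1) * c := Nat.mul_le_mul_left _ (by omega)
      omega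
    interval_cases c <;> omega
  · rintro rfl; exact dvd_rfl

lemma kernel_sum {F : Type*} [Field F] [Fintype F] [CharP F 2] (n : ℕ) (hn : 2 ≤ n)
    (hcard : Fintype.card F = 2 ^ n) (j : ℕ) (hj : j < n) (s : ℕ) (hs : s ≤ 2 ^ n - 1) (x : F) :
    ∑ y : F, y ^ s * (x + y) ^ (2 ^ n - 1 - 2 ^ j) = (s.choose (2 ^ j) : F) * x ^ (s - 2 ^ j) := by
  have h2 : (2 : F) = 0 := CharTwo.two_eq_zero
  have hjn : 2 * 2 ^ j ≤ 2 ^ n := by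
    rw [← pow_succ']; exact Nat.pow_le_pow_right (by norm_num) hj
  have h4 : 4 ≤ 2 ^ n := by
    calc 4 = 2 ^ 2 := rfl
      _ ≤ _ := Nat.pow_le_pow_right (by norm_num) hn
  have hj0 : 1 ≤ 2 ^ j := Nat.one_le_two_pow
  rw [← Equiv.sum_comp (Equiv.addRight x)]
  have h3 : ∀ u : F, ((Equiv.addRight x) u) ^ s * (x + (Equiv.addRight x) u) ^ (2 ^ n - 1 - 2 ^ j)
      = ∑ m ∈ Finset.range (s + 1), (x ^ (s - m) * (s.choose m : F)) * u ^ (m + (2 ^ n - 1 - 2 ^ j)) := by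
    intro u
    have : x + (Equiv.addRight x) u = u := by
      simp only [Equiv.coe_addRight]; linear_combination x * h2
    rw [this, Equiv.coe_addRight, add_pow, Finset.sum_mul]
    refine Finset.sum_congr rfl fun m _ => ?_
    rw [pow_add]; ring
  rw [Finset.sum_congr rfl fun u _ => h3 u, Finset.sum_comm]
  have h5 : ∀ m ∈ Finset.range (s + 1),
      ∑ u : F, (x ^ (s - m) * (s.choose m : F)) * u ^ (m + (2 ^ n - 1 - 2 ^ j)) =
      if m = 2 ^ j then (x ^ (s - 2 ^ j) * (s.choose (2 ^ j) : F)) else 0 := by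
    intro m hm
    rw [Finset.mem_range] at hm
    rw [← Finset.mul_sum, sum_pow_all _ (by omega) (by omega), hcard]
    by_cases h : m = 2 ^ j
    · rw [if_pos h, if_pos (by omega), h]
      linear_combination (-(x ^ (s - 2 ^ j) * (s.choose (2 ^ j) : F))) * h2
    · rw [if_neg h, if_neg (by omega), mul_zero]
  rw [Finset.sum_congr rfl h5, Finset.sum_ite_eq']
  split_ifs with h
  · ring
  · rw [Finset.mem_range] at h
    rw [Nat.choose_eq_zero_of_lt (by omega)]; simp

/-- Moments. -/
def mom {F : Type*} [Field F] [Fintype F] (a : F → F) (j N : ℕ) : F :=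
  ∑ x : F, a x ^ 2 ^ j * x ^ (N - 2 ^ j)

lemma mom_rel {F : Type*} [Field F] [Fintype F] [CharP F 2] (n : ℕ) (hn : 2 ≤ n)
    (hcard : Fintype.card F = 2 ^ n) (a : F → F)
    (ha : ∀ b b', b ≠ b' → trc n ((a b - a b') / (b - b')) = 0)
    (r s : ℕ) (hr : r ≤ 2 ^ n - 1) (hs : s ≤ 2 ^ n - 1) :
    ∑ j ∈ Finset.range n, ((r.choose (2 ^ j) : F) + (s.choose (2 ^ j) : F)) * mom a j (r + s) = 0 := by
  have h2 : (2 : F) = 0 := CharTwo.two_eq_zero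
  have key : ∀ x y : F, ∑ j ∈ Finset.range n,
      (a x ^ 2 ^ j + a y ^ 2 ^ j) * (x + y) ^ (2 ^ n - 1 - 2 ^ j) = 0 := by
    intro x y
    by_cases hxy : x = y
    · subst hxy
      refine Finset.sum_eq_zero fun j _ => ?_
      linear_combination (a x ^ 2 ^ j) * (x + x) ^ (2 ^ n - 1 - 2 ^ j) * h2
    · have hu : x + y ≠ 0 := by
        intro h; apply hxy; linear_combination h - y * h2
      rw [← ha x y hxy, trc]
      refine Finset.sum_congr rfl fun j hj => ?_
      rw [Finset.mem_range] at hj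
      have hjn : 2 * 2 ^ j ≤ 2 ^ n := by
        rw [← pow_succ']; exact Nat.pow_le_pow_right (by norm_num) hj
      have hj0 : 1 ≤ 2 ^ j := Nat.one_le_two_pow
      have e1 : a x - a y = a x + a y := CharTwo.sub_eq_add _ _
      have e2 : x - y = x + y := CharTwo.sub_eq_add _ _
      rw [e1, e2, div_pow, add_pow_char_pow, eq_div_iff (pow_ne_zero _ hu), mul_assoc, ← pow_add,
        show 2 ^ n - 1 - 2 ^ j + 2 ^ j = 2 ^ n - 1 by omega, ← hcard,
        FiniteField.pow_card_sub_one_eq_one _ hu, mul_one]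
  have h0 : ∑ x : F, ∑ y : F, x ^ r * y ^ s * ∑ j ∈ Finset.range n,
      (a x ^ 2 ^ j + a y ^ 2 ^ j) * (x + y) ^ (2 ^ n - 1 - 2 ^ j) = 0 := by
    refine Finset.sum_eq_zero fun x _ => Finset.sum_eq_zero fun y _ => ?_
    rw [key, mul_zero]
  have h1 : ∀ j ∈ Finset.range n,
      ((r.choose (2 ^ j) : F) + (s.choose (2 ^ j) : F)) * mom a j (r + s) =
      ∑ x : F, ∑ y : F, x ^ r * y ^ s * ((a x ^ 2 ^ j + a y ^ 2 ^ j) * (x + y) ^ (2 ^ n - 1 - 2 ^ j)) := by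
    intro j hj
    rw [Finset.mem_range] at hj
    have e1 : ∑ x : F, ∑ y : F, x ^ r * y ^ s * ((a x ^ 2 ^ j + a y ^ 2 ^ j) * (x + y) ^ (2 ^ n - 1 - 2 ^ j))
      = ∑ x : F, ∑ y : F, (a x ^ 2 ^ j * x ^ r) * (y ^ s * (x + y) ^ (2 ^ n - 1 - 2 ^ j))
      + ∑ y : F, ∑ x : F, (a y ^ 2 ^ j * y ^ s) * (x ^ r * (y + x) ^ (2 ^ n - 1 - 2 ^ j)) := by
      rw [Finset.sum_comm (f := fun y x => (a y ^ 2 ^ j * y ^ s) * (x ^ r * (y + x) ^ (2 ^ n - 1 - 2 ^ j))),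
        ← Finset.sum_add_distrib]
      refine Finset.sum_congr rfl fun x _ => ?_
      rw [← Finset.sum_add_distrib]
      refine Finset.sum_congr rfl fun y _ => ?_
      rw [add_comm y x]; ring
    rw [e1]
    simp_rw [← Finset.mul_sum, kernel_sum n hn hcard j hj s hs, kernel_sum n hn hcard j hj r hr]
    rw [add_mul, add_comm, mom]
    congr 1
    · rw [Finset.mul_sum]
      refine Finset.sum_congr rfl fun x _ => ?_
      by_cases h : s < 2 ^ j
      · rw [Nat.choose_eq_zero_of_lt h]; simp
      · rw [show r + s - 2 ^ j = r + (s - 2 ^ j) by omega, pow_add]; ring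
    · rw [Finset.mul_sum]
      refine Finset.sum_congr rfl fun x _ => ?_
      by_cases h : r < 2 ^ j
      · rw [Nat.choose_eq_zero_of_lt h]; simp
      · rw [show r + s - 2 ^ j = s + (r - 2 ^ j) by omega, pow_add]; ring
  rw [Finset.sum_congr rfl h1, ← h0, Finset.sum_comm]
  refine Finset.sum_congr rfl fun x _ => ?_
  rw [Finset.sum_comm]
  refine Finset.sum_congr rfl fun y _ => ?_
  rw [Finset.mul_sum]

lemma choose_two_pow_mod (j : ℕ) : ∀ r : ℕ, r.choose (2 ^ j) ≡ r / 2 ^ j [MOD 2] := by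
  induction j with
  | zero => intro r; simp [Nat.ModEq]
  | succ j ih =>
    intro r
    haveI : Fact (Nat.Prime 2) := ⟨Nat.prime_two⟩
    have h := Choose.choose_modEq_choose_mod_mul_choose_div_nat (n := r) (k := 2 ^ (j + 1)) (p := 2)
    rw [show 2 ^ (j + 1) % 2 = 0 by rw [pow_succ]; simp, show 2 ^ (j + 1) / 2 = 2 ^ j by rw [pow_succ]; simp,
      Nat.choose_zero_right, one_mul] at h
    rw [pow_succ', ← Nat.div_div_eq_div_mul, ← pow_succ']
    exact h.trans (ih (r / 2))

lemma cast_choose {F : Type*} [Field F] [CharP F 2] (j r : ℕ) :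
    (r.choose (2 ^ j) : F) = ((r / 2 ^ j : ℕ) : F) :=
  (CharP.cast_eq_iff_mod_eq F 2).2 (choose_two_pow_mod j r)

lemma mom_low {F : Type*} [Field F] [Fintype F] [CharP F 2] (n : ℕ) (hn : 2 ≤ n)
    (hcard : Fintype.card F = 2 ^ n) (a : F → F)
    (ha : ∀ b b', b ≠ b' → trc n ((a b - a b') / (b - b')) = 0)
    (L R c d : ℕ) (hL : L ≤ n) (hc : c < 2 ^ L) (hd : d < 2 ^ L) (hR : 2 ^ L * (R + 1) ≤ 2 ^ n) :
    ∑ j ∈ Finset.range L, (((c / 2 ^ j : ℕ) : F) + ((d / 2 ^ j : ℕ) : F)) *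
      mom a j (2 ^ L * R + c + (2 ^ L * R + d)) = 0 := by
  have h2 : (2 : F) = 0 := CharTwo.two_eq_zero
  rw [mul_add, mul_one] at hR
  have h := mom_rel n hn hcard a ha (2 ^ L * R + c) (2 ^ L * R + d) (by omega) (by omega)
  rw [← h]
  apply Finset.sum_subset_zero_on_sdiff (Finset.range_subset_range.2 hL)
  · intro j hj
    simp only [Finset.mem_sdiff, Finset.mem_range, not_lt] at hj
    obtain ⟨k, rfl⟩ := Nat.exists_eq_add_of_le hj.2
    have e : ∀ c < 2 ^ L, (2 ^ L * R + c) / 2 ^ (L + k) = R / 2 ^ k := by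
      intro c hc
      rw [pow_add, ← Nat.div_div_eq_div_mul, Nat.mul_add_div (by positivity), Nat.div_eq_of_lt hc, add_zero]
    rw [cast_choose, cast_choose, e c hc, e d hd]
    linear_combination (((R / 2 ^ k : ℕ) : F)) * mom a (L + k) (2 ^ L * R + c + (2 ^ L * R + d)) * h2
  · intro j hj
    rw [Finset.mem_range] at hj
    obtain ⟨k, rfl⟩ := Nat.exists_eq_add_of_le hj.le
    have e : ∀ c, (2 ^ (j + k) * R + c) / 2 ^ j = 2 ^ k * R + c / 2 ^ j := by
      intro c
      rw [pow_add, mul_assoc, Nat.mul_add_div (by positivity)]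
    rw [cast_choose, cast_choose, e, e]
    push_cast
    linear_combination (-(2 ^ k * (R : F)) * mom a j (2 ^ (j + k) * R + c + (2 ^ (j + k) * R + d))) * h2

lemma mom_period {F : Type*} [Field F] [Fintype F] (a : F → F) (h0 : a 0 = 0) (j N : ℕ)
    (hj : 2 ^ j ≤ N) : mom a j (N + (Fintype.card F - 1)) = mom a j N := by
  unfold mom
  refine Finset.sum_congr rfl fun x _ => ?_
  by_cases hx : x = 0
  · rw [hx, h0, zero_pow (by positivity)]; simp
  · rw [show N + (Fintype.card F - 1) - 2 ^ j = (N - 2 ^ j) + (Fintype.card F - 1) by omega, pow_add,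
      FiniteField.pow_card_sub_one_eq_one _ hx, mul_one]

lemma cast_sub_div {F : Type*} [Field F] [CharP F 2] (L j e : ℕ) (hj : j < L) (he1 : 1 ≤ e)
    (he : e ≤ 2 ^ j) : (((2 ^ L - e) / 2 ^ j : ℕ) : F) = 1 := by
  have h2 : (2 : F) = 0 := CharTwo.two_eq_zero
  obtain ⟨k, rfl⟩ := Nat.exists_eq_add_of_lt hj
  have h : (2 ^ (j + k + 1) - e) / 2 ^ j = 2 * (2 ^ k - 1) + 1 := by
    have hk : 1 ≤ 2 ^ k := Nat.one_le_two_pow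
    obtain ⟨K, hK⟩ : ∃ K, 2 ^ k = K + 1 := ⟨2 ^ k - 1, by omega⟩
    rw [show 2 ^ (j + k + 1) = 2 ^ j * (2 * (2 ^ k - 1) + 1) + 2 ^ j by
      rw [pow_add, pow_add, hK]; simp only [Nat.add_sub_cancel]; ring,
      Nat.add_sub_assoc he, Nat.mul_add_div (by positivity), Nat.div_eq_of_lt (by omega), add_zero]
  rw [h]
  push_cast
  linear_combination ((2 ^ k - 1 : ℕ) : F) * h2

lemma mom_zero {F : Type*} [Field F] [Fintype F] [CharP F 2] (n : ℕ) (hn : 2 ≤ n)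
    (hcard : Fintype.card F = 2 ^ n) (a : F → F) (h0 : a 0 = 0)
    (ha : ∀ b b', b ≠ b' → trc n ((a b - a b') / (b - b')) = 0)
    (N : ℕ) (hN1 : 1 ≤ N) (hN2 : N + 2 ≤ 2 ^ n) : mom a 0 N = 0 := by
  have h2 : (2 : F) = 0 := CharTwo.two_eq_zero
  suffices H : ∃ L, 1 ≤ L ∧ ∑ j ∈ Finset.range L, mom a j N = 0 ∧
      ∑ j ∈ Finset.range L, (if j = 0 then 0 else 1) * mom a j N = 0 by
    obtain ⟨L, hL, e1, e2⟩ := H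
    have e3 : ∑ j ∈ Finset.range L, (if j = 0 then mom a j N else 0) = 0 := by
      have : ∀ j ∈ Finset.range L, (if j = 0 then mom a j N else 0) =
          mom a j N - (if j = 0 then 0 else 1) * mom a j N := by
        intro j _; split_ifs <;> ring
      rw [Finset.sum_congr rfl this, Finset.sum_sub_distrib, e1, e2, sub_zero]
    rwa [Finset.sum_ite_eq', if_pos (Finset.mem_range.2 hL)] at e3
  have hdec : ∀ K, 1 ≤ K → K < 2 ^ n → ∃ L M Q, K = 2 ^ L * (2 * M + 1) ∧ 2 ^ n = 2 ^ L * (2 * Q) ∧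
      M < Q ∧ L < n := by
    intro K hK hKn
    obtain ⟨L, m, hm, rfl⟩ := Nat.exists_eq_two_pow_mul_odd (by omega : K ≠ 0)
    obtain ⟨M, rfl⟩ := hm
    have hLn : L < n := by
      by_contra h
      have h5 : 2 ^ n ≤ 2 ^ L := Nat.pow_le_pow_right (by norm_num) (by omega)
      nlinarith [Nat.zero_le (2 ^ L * M)]
    obtain ⟨k, rfl⟩ := Nat.exists_eq_add_of_lt hLn
    have h6 : 2 ^ (L + k + 1) = 2 ^ L * (2 * 2 ^ k) := by ring
    refine ⟨L, M, 2 ^ k, rfl, h6, ?_, hLn⟩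
    rw [h6] at hKn
    have := Nat.lt_of_mul_lt_mul_left hKn
    omega
  have per : ∀ L, (∀ j < L, 2 ^ j ≤ N) → ∀ w : ℕ → F,
      ∑ j ∈ Finset.range L, w j * mom a j (N + (2 ^ n - 1)) = ∑ j ∈ Finset.range L, w j * mom a j N := by
    intro L hL w
    refine Finset.sum_congr rfl fun j hj => ?_
    rw [← hcard, mom_period a h0 j N (hL j (Finset.mem_range.1 hj))]
  have hn1 : 1 ≤ 2 ^ n := Nat.one_le_two_pow
  -- coefficient simplifications
  have co1 : ∀ L N', ∑ j ∈ Finset.range L, (((0 / 2 ^ j : ℕ) : F) + (((2 ^ L - 1) / 2 ^ j : ℕ) : F)) *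
      mom a j N' = ∑ j ∈ Finset.range L, 1 * mom a j N' := by
    intro L N'
    refine Finset.sum_congr rfl fun j hj => ?_
    rw [cast_sub_div L j 1 (Finset.mem_range.1 hj) le_rfl Nat.one_le_two_pow]; simp
  rcases Nat.even_or_odd N with hev | hod
  · obtain ⟨L, M, Q, hN, hQ, hMQ, hLn⟩ := hdec N hN1 (by omega)
    have hL1 : 1 ≤ L := by
      by_contra h
      have : L = 0 := by omega
      rw [this] at hN
      obtain ⟨k, hk⟩ := hev
      omega
    have hL2 : 2 ≤ 2 ^ L := Nat.le_self_pow (by omega) 2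
    have hjN : ∀ j < L, 2 ^ j ≤ N := by
      intro j hj
      have : 2 ^ j ≤ 2 ^ L := Nat.pow_le_pow_right (by norm_num) hj.le
      nlinarith [Nat.zero_le (2 ^ L * M)]
    refine ⟨L, hL1, ?_, ?_⟩
    · have h := mom_low n hn hcard a ha L (M + Q) 0 (2 ^ L - 1) hLn.le (by omega) (by omega) (by
        rw [hQ]; exact Nat.mul_le_mul_left _ (by omega))
      rw [co1, show 2 ^ L * (M + Q) + 0 + (2 ^ L * (M + Q) + (2 ^ L - 1)) = N + (2 ^ n - 1) by
        have : 2 ^ L * (M + Q) + (2 ^ L * (M + Q) + 2 ^ L) = N + 2 ^ n := by rw [hN, hQ]; ring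
        omega, per L hjN] at h
      simpa using h
    · have h := mom_low n hn hcard a ha L M 1 (2 ^ L - 1) hLn.le (by omega) (by omega) (by
        rw [hQ]; exact Nat.mul_le_mul_left _ (by omega))
      rw [show 2 ^ L * M + 1 + (2 ^ L * M + (2 ^ L - 1)) = N by
        have : 2 ^ L * M + (2 ^ L * M + 2 ^ L) = N := by rw [hN]; ring
        omega] at h
      refine Eq.trans ?_ h
      refine Finset.sum_congr rfl fun j hj => ?_
      rw [cast_sub_div L j 1 (Finset.mem_range.1 hj) le_rfl Nat.one_le_two_pow]
      congr 1
      split_ifs with hj0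
      · subst hj0; simp [CharTwo.add_self_eq_zero]
      · rw [Nat.div_eq_of_lt (Nat.one_lt_two_pow hj0)]; simp
  · obtain ⟨L, M, Q, hN, hQ, hMQ, hLn⟩ := hdec (N + 1) (by omega) (by omega)
    have hL1 : 1 ≤ L := by
      by_contra h
      have : L = 0 := by omega
      rw [this] at hN
      obtain ⟨k, hk⟩ := hod
      omega
    have hL2 : 2 ≤ 2 ^ L := Nat.le_self_pow (by omega) 2
    have hjN : ∀ j < L, 2 ^ j ≤ N := by
      intro j hj
      have h7 : 2 * 2 ^ j ≤ 2 ^ L := by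
        rw [← pow_succ']; exact Nat.pow_le_pow_right (by norm_num) hj
      have h8 : 1 ≤ 2 ^ j := Nat.one_le_two_pow
      nlinarith [Nat.zero_le (2 ^ L * M)]
    refine ⟨L, hL1, ?_, ?_⟩
    · have h := mom_low n hn hcard a ha L M 0 (2 ^ L - 1) hLn.le (by omega) (by omega) (by
        rw [hQ]; exact Nat.mul_le_mul_left _ (by omega))
      rw [co1, show 2 ^ L * M + 0 + (2 ^ L * M + (2 ^ L - 1)) = N by
        have : 2 ^ L * M + (2 ^ L * M + 2 ^ L) = N + 1 := by rw [hN]; ring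
        omega] at h
      simpa using h
    · have h := mom_low n hn hcard a ha L (M + Q) 0 (2 ^ L - 2) hLn.le (by omega) (by omega) (by
        rw [hQ]; exact Nat.mul_le_mul_left _ (by omega))
      rw [show 2 ^ L * (M + Q) + 0 + (2 ^ L * (M + Q) + (2 ^ L - 2)) = N + (2 ^ n - 1) by
        have : 2 ^ L * (M + Q) + (2 ^ L * (M + Q) + 2 ^ L) = N + 1 + 2 ^ n := by rw [hN, hQ]; ring
        omega, per L hjN] at h
      refine Eq.trans ?_ h
      refine Finset.sum_congr rfl fun j hj => ?_
      congr 1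
      split_ifs with hj0
      · subst hj0
        obtain ⟨k, rfl⟩ : ∃ k, L = k + 1 := ⟨L - 1, by omega⟩
        have : 2 ^ (k + 1) - 2 = 2 * (2 ^ k - 1) := by rw [pow_succ]; omega
        rw [pow_zero, Nat.div_one, Nat.div_one, this]
        push_cast
        linear_combination (-((2 ^ k - 1 : ℕ) : F)) * h2
      · rw [cast_sub_div L j 2 (Finset.mem_range.1 hj) (by norm_num) (Nat.le_self_pow hj0 2)]; simp

lemma full_case {F : Type*} [Field F] [Fintype F] [CharP F 2] (n : ℕ) (hn : 2 ≤ n)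
    (hcard : Fintype.card F = 2 ^ n) (a : F → F)
    (ha : ∀ b b', b ≠ b' → trc n ((a b - a b') / (b - b')) = 0) :
    ∃ A B : F, ∀ x, a x = A * x + B := by
  classical
  have h2 : (2 : F) = 0 := CharTwo.two_eq_zero
  have h4 : 4 ≤ 2 ^ n := by
    calc 4 = 2 ^ 2 := rfl
      _ ≤ _ := Nat.pow_le_pow_right (by norm_num) hn
  set f : F → F := fun x => a x - a 0 with hf
  have hm := mom_zero n hn hcard f (by simp [hf]) (by
    intro b b' hb
    rw [← ha b b' hb]; congr 2; simp only [hf]; ring)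
  have hm' : ∀ k, k + 3 ≤ 2 ^ n → ∑ c : F, f c * c ^ k = 0 := by
    intro k hk
    have := hm (k + 1) (by omega) (by omega)
    simpa [mom] using this
  obtain ⟨e, he⟩ : ∃ e, 2 ^ n = e + 2 := ⟨2 ^ n - 2, by omega⟩
  have hint : ∀ x, ∑ c : F, f c * (c + x) ^ (e + 1) = f x := by
    intro x
    have e1 : ∀ c, f c * (c + x) ^ (e + 1) = f c - (if c = x then f c else 0) := by
      intro c
      split_ifs with h
      · rw [h, CharTwo.add_self_eq_zero, zero_pow (by omega)]; simp
      · have hcx : c + x ≠ 0 := by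
          intro h'; apply h; linear_combination h' - x * h2
        have := FiniteField.pow_card_sub_one_eq_one _ hcx
        rw [hcard, he] at this
        rw [show e + 1 = e + 2 - 1 by omega, this]; simp
    have e2 : ∑ c : F, f c = 0 := by simpa using hm' 0 (by omega)
    rw [Finset.sum_congr rfl fun c _ => e1 c, Finset.sum_sub_distrib, e2, Finset.sum_ite_eq',
      if_pos (Finset.mem_univ _)]
    linear_combination (-f x) * h2
  refine ⟨(∑ c : F, f c * c ^ e) * ((e + 1).choose e : F), (∑ c : F, f c * c ^ (e + 1)) + a 0, fun x => ?_⟩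
  have h5 : f x = ∑ m ∈ Finset.range (e + 2), (∑ c : F, f c * c ^ m) * (x ^ (e + 1 - m) * ((e + 1).choose m : F)) := by
    rw [← hint x]
    simp_rw [add_pow, Finset.mul_sum, Finset.sum_mul]
    rw [Finset.sum_comm]
    refine Finset.sum_congr rfl fun m _ => Finset.sum_congr rfl fun c _ => ?_
    ring
  rw [Finset.sum_range_succ, Finset.sum_range_succ, Finset.sum_eq_zero] at h5
  · rw [show e + 1 - e = 1 by omega] at h5
    simp only [hf] at h5 ⊢
    simp only [Nat.sub_self, pow_zero, Nat.choose_self, Nat.cast_one, pow_one] at h5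
    linear_combination h5
  · intro m hmm
    rw [Finset.mem_range] at hmm
    rw [hm' m (by omega), zero_mul]

lemma trc_image {F : Type*} [Field F] [Fintype F] [CharP F 2] (n : ℕ)
    (hcard : Fintype.card F = 2 ^ n) (x : F) : trc n (x + x ^ 2) = 0 := by
  have h : ∀ k, trc k (x + x ^ 2) = x ^ 2 ^ k + x := by
    intro k
    induction k with
    | zero => simp [trc, CharTwo.add_self_eq_zero]
    | succ k ih =>
      have : trc (k + 1) (x + x ^ 2) = trc k (x + x ^ 2) + (x + x ^ 2) ^ 2 ^ k := by
        simp [trc, Finset.sum_range_succ]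
      rw [this, ih, add_pow_char_pow, ← pow_mul, ← pow_succ']
      have h2 : (2 : F) = 0 := CharTwo.two_eq_zero
      linear_combination x ^ 2 ^ k * h2
  rw [h, ← hcard, FiniteField.pow_card, CharTwo.add_self_eq_zero]

/-- Let `q = 2^n > 2` and `U` an intersecting family of polynomials over `F_q` of degree at
most `2`. For `t ∈ F_q` let `B_t = {b : ∃ a, a + bx + (b+t)x² ∈ U}` and
`Dom = {t : |B_t| ≥ q − √q/2}`. Then for every `t ∈ Dom` there exist `A, B ∈ F_q` with
`Tr_{q/2}(A) = 0` (the absolute trace `A + A² + A⁴ + ⋯ + A^{2^{n−1}}` vanishes) such that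
for every `b ∈ B_t` the constant term `a` of the member `a + bx + (b+t)x²` of `U` equals
`A·b + B`. -/
theorem stmt16 (n : ℕ) (F : Type*) [Field F] [Fintype F]
    (hcard : Fintype.card F = 2 ^ n) (hq : 2 < Fintype.card F)
    (U : Set (Polynomial F)) (hdeg : ∀ f ∈ U, f.natDegree ≤ 2)
    (hint : ∀ f ∈ U, ∀ g ∈ U, ∃ x : F, f.eval x = g.eval x) :
    ∀ t : F,
      (Fintype.card F : ℝ) - Real.sqrt (Fintype.card F) / 2 ≤
        ({b : F | ∃ a : F, C a + C b * X + C (b + t) * X ^ 2 ∈ U}.ncard : ℝ) →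
      ∃ A B : F, (∑ i ∈ Finset.range n, A ^ 2 ^ i) = 0 ∧
        ∀ b a : F, C a + C b * X + C (b + t) * X ^ 2 ∈ U → a = A * b + B := by
  classical
  intro t ht
  have hn : 2 ≤ n := by
    by_contra h
    have h' : n ≤ 1 := by omega
    have := Nat.pow_le_pow_right (n := 2) (by norm_num) h'
    omega
  haveI : Fact (Nat.Prime 2) := ⟨Nat.prime_two⟩
  haveI : CharP F 2 := charP_of_card_eq_prime_pow hcard
  have hslope : ∀ b b' a a' : F, C a + C b * X + C (b + t) * X ^ 2 ∈ U →
      C a' + C b' * X + C (b' + t) * X ^ 2 ∈ U →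
      ∃ x : F, a - a' = (b - b') * (x + x ^ 2) := by
    intro b b' a a' h h'
    obtain ⟨x, hx⟩ := hint _ h _ h'
    simp only [eval_add, eval_mul, eval_C, eval_X, eval_pow] at hx
    refine ⟨x, ?_⟩
    have h2 : (2 : F) = 0 := CharTwo.two_eq_zero
    linear_combination hx + ((b' - b) * x + (b' - b) * x ^ 2) * h2
  set S : Finset F := Finset.univ.filter fun b => ∃ a : F, C a + C b * X + C (b + t) * X ^ 2 ∈ U with hS
  have hSc : {b : F | ∃ a : F, C a + C b * X + C (b + t) * X ^ 2 ∈ U}.ncard = S.card := by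
    rw [← Set.ncard_coe_finset]; congr 1; ext b; simp [hS]
  rw [hSc] at ht
  have hch : ∀ b, ∃ a : F, b ∈ S → C a + C b * X + C (b + t) * X ^ 2 ∈ U := by
    intro b
    by_cases hb : b ∈ S
    · obtain ⟨a, ha⟩ := (Finset.mem_filter.1 hb).2
      exact ⟨a, fun _ => ha⟩
    · exact ⟨0, fun h => absurd h hb⟩
  choose a ha using hch
  have hcount : 4 * Sᶜ.card ^ 2 ≤ Fintype.card F := by
    have h1 : (S.card : ℝ) + Sᶜ.card = Fintype.card F := by
      exact_mod_cast Finset.card_add_card_compl S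
    have h2 := Real.sq_sqrt (Nat.cast_nonneg (α := ℝ) (Fintype.card F))
    have h3 : (2 * (Sᶜ.card : ℝ)) ≤ Real.sqrt (Fintype.card F) := by linarith
    have h4 : (4 * (Sᶜ.card : ℝ) ^ 2) ≤ Fintype.card F := by
      have := pow_le_pow_left₀ (by positivity) h3 2
      nlinarith
    exact_mod_cast h4
  obtain ⟨a', h1, h2⟩ := extend_all n hcard hq _ S a rfl hcount (by
    intro b hb b' hb' hne
    obtain ⟨x, hx⟩ := hslope b b' (a b) (a b') (ha b hb) (ha b' hb')
    rw [hx, mul_div_cancel_left₀ _ (sub_ne_zero.2 hne)]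
    exact trc_image n hcard x)
  obtain ⟨A, B, hAB⟩ := full_case n hn hcard a' h2
  refine ⟨A, B, ?_, fun b c hc => ?_⟩
  · have := h2 1 0 one_ne_zero
    rw [hAB, hAB] at this
    simpa [trc] using this
  · have hb : b ∈ S := Finset.mem_filter.2 ⟨Finset.mem_univ _, c, hc⟩
    obtain ⟨x, hx⟩ := hslope b b c (a b) hc (ha b hb)
    rw [sub_self, zero_mul, sub_eq_zero] at hx
    rw [hx, ← h1 b hb, hAB]
end
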